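/- Assume 1/4 < s' ≤ 1, 1/2 < s ≤ 1, max(3/2 − 2s, s/2 − 1/8) < s' < 4s − 3/2, 1/2 < θ₀ < 3/4, and max(1/2, 1 − s') < θ₁ < min(3/4, 4s − s' − 1, 2s − 1/2). Then there exists ε₀ > 0 such that for every ε with 0 < ε ≤ ε₀ there exists a constant C > 0 such that for all Schwartz functions u, v on ℝ^{1+2}, ‖uv‖_{H^{s'−3/2, θ₁−1+ε}} ≤ C ‖u‖_{H^{s−1/2, θ₀−1/2}} ‖v‖_{H^{s−1/2, θ₀}}. -/

import Mathlib

open MeasureTheory Real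
open scoped FourierTransform

noncomputable section

/-- Space-time ℝ^{1+2}: coordinate 0 is time `t`, coordinates 1,2 are space `x`. -/
abbrev SpaceTime := EuclideanSpace ℝ (Fin 3)

/-- The magnitude `|ξ|` of the spatial part of a frequency point `(τ, ξ) ∈ ℝ × ℝ²`. -/
def spFreq (ζ : SpaceTime) : ℝ := Real.sqrt ((ζ 1) ^ 2 + (ζ 2) ^ 2)

/-- The wave-Sobolev norm
`‖u‖_{H^{s,b}} = (∫ (1+|ξ|²)^s (1+||τ|-|ξ||)^{2b} |û(τ,ξ)|² dτ dξ)^{1/2}`. -/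
def waveNorm (s b : ℝ) (f : SpaceTime → ℂ) : ℝ :=
  (∫ ζ : SpaceTime, (1 + (spFreq ζ) ^ 2) ^ s * (1 + |(|ζ 0| - spFreq ζ)|) ^ (2 * b) *
    ‖𝓕 f ζ‖ ^ 2) ^ (1/2 : ℝ)

/-- The decaying weight `(1 + |x|)^(-p)`. -/
def decay (p x : ℝ) : ℝ := (1 + |x|) ^ (-p)

lemma decay_pos (p x : ℝ) : 0 < decay p x := by unfold decay; positivity

lemma decay_nonneg (p x : ℝ) : 0 ≤ decay p x := (decay_pos p x).le

lemma decay_anti {p x y : ℝ} (hp : 0 ≤ p) (h : |x| ≤ |y|) : decay p y ≤ decay p x :=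
  rpow_le_rpow_of_nonpos (by positivity) (by linarith) (by linarith)

@[fun_prop]
lemma continuous_decay (p : ℝ) : Continuous (decay p) := by
  unfold decay
  exact (by fun_prop : Continuous fun x : ℝ => 1 + |x|).rpow_const
    fun x => Or.inl (by positivity)

@[fun_prop]
lemma measurable_decay (p : ℝ) : Measurable (decay p) := (continuous_decay p).measurable

lemma integrable_decay {p : ℝ} (hp : 1 < p) : Integrable (decay p) := by
  have := integrable_one_add_norm (E := ℝ) (μ := volume) (r := p) (by simpa using hp)
  exact this

lemma decay_le_of_mul_le {p x y k : ℝ} (hp : 0 ≤ p) (hk : 0 < k) (h : k * (1 + |y|) ≤ 1 + |x|) :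
    decay p x ≤ k ^ (-p) * decay p y := by
  unfold decay
  rw [← mul_rpow hk.le (by positivity)]
  exact rpow_le_rpow_of_nonpos (by positivity) h (by linarith)

lemma lintegral_decay_abs_sub_le {p : ℝ} (hp : 1 < p) :
    ∃ C : ℝ, 0 < C ∧ ∀ x c : ℝ,
      ∫⁻ t : ℝ, ENNReal.ofReal (decay p (|c + t| - x)) ≤ ENNReal.ofReal C := by
  set K := ∫ t : ℝ, decay p t with hK
  have hK0 : 0 ≤ K := integral_nonneg (decay_nonneg p)
  have hlin : ∀ a : ℝ, ∫⁻ t : ℝ, ENNReal.ofReal (decay p (t + a)) = ENNReal.ofReal K := by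
    intro a
    rw [lintegral_add_right_eq_self (fun t => ENNReal.ofReal (decay p t)) a,
      ← ofReal_integral_eq_lintegral_ofReal (integrable_decay hp)
        (Filter.Eventually.of_forall (decay_nonneg p))]
  refine ⟨K + K + 1, by linarith, fun x c => ?_⟩
  calc ∫⁻ t : ℝ, ENNReal.ofReal (decay p (|c + t| - x))
      ≤ ∫⁻ t : ℝ, (ENNReal.ofReal (decay p (t + (c - x))) +
          ENNReal.ofReal (decay p (t + (c + x)))) := by
        refine lintegral_mono fun t => ?_
        rw [← ENNReal.ofReal_add (decay_nonneg _ _) (decay_nonneg _ _)]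
        refine ENNReal.ofReal_le_ofReal ?_
        rcases le_total 0 (c + t) with h | h
        · rw [abs_of_nonneg h, show c + t - x = t + (c - x) by ring]
          linarith [decay_nonneg p (t + (c + x))]
        · rw [abs_of_nonpos h, show -(c + t) - x = -(t + (c + x)) by ring]
          have : decay p (-(t + (c + x))) = decay p (t + (c + x)) := by
            unfold decay; rw [abs_neg]
          linarith [decay_nonneg p (t + (c - x))]
    _ = ENNReal.ofReal (K + K) := by
        rw [lintegral_add_left (by fun_prop), hlin, hlin, ENNReal.ofReal_add hK0 hK0]
    _ ≤ _ := ENNReal.ofReal_le_ofReal (by linarith)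

/-- Integrating two decaying weights against each other in the time frequency leaves the
weight with the smaller exponent. -/
lemma lintegral_decay_mul_decay_le {p γ : ℝ} (hp : 1 < p) (hγ : 0 < γ) (hγp : γ ≤ p) :
    ∃ C : ℝ, 0 < C ∧ ∀ c x y d : ℝ, 0 ≤ d → (∀ t, d ≤ |(|t| - x)| + |(|c + t| - y)|) →
      ∫⁻ t : ℝ, ENNReal.ofReal (decay p (|t| - x) * decay γ (|c + t| - y)) ≤
        ENNReal.ofReal (C * decay γ d) := by
  obtain ⟨K, hK, hKb⟩ := lintegral_decay_abs_sub_le hp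
  have h2 : (0 : ℝ) < (1 / 2) ^ (-γ) := by positivity
  refine ⟨(1 / 2) ^ (-γ) * (K + K), by positivity, fun c x y d hd0 hd => ?_⟩
  have hsplit : ∀ q z : ℝ, decay p z = decay q z * decay (p - q) z := by
    intro q z
    unfold decay
    rw [← rpow_add (by positivity)]; congr 1; ring
  have hconst : 0 ≤ (1 / 2) ^ (-γ) * decay γ d := mul_nonneg h2.le (decay_nonneg γ d)
  have hpt : ∀ t, decay p (|t| - x) * decay γ (|c + t| - y) ≤
      ((1 / 2) ^ (-γ) * decay γ d) * (decay p (|t| - x) + decay p (|c + t| - y)) := by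
    intro t
    have hdt := hd t
    set A := |t| - x
    set B := |c + t| - y
    have pA := decay_nonneg p A
    have pB := decay_nonneg p B
    rcases le_total |A| |B| with h | h
    · have : decay γ B ≤ (1 / 2) ^ (-γ) * decay γ d :=
        decay_le_of_mul_le hγ.le (by norm_num) (by rw [abs_of_nonneg hd0]; linarith)
      nlinarith [mul_le_mul_of_nonneg_left this pA, mul_nonneg hconst pB]
    · have h1 : decay γ A ≤ (1 / 2) ^ (-γ) * decay γ d :=
        decay_le_of_mul_le hγ.le (by norm_num) (by rw [abs_of_nonneg hd0]; linarith)
      have h3 : decay (p - γ) A ≤ decay (p - γ) B := decay_anti (by linarith) h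
      calc decay p A * decay γ B = decay γ A * (decay (p - γ) A * decay γ B) := by
            rw [hsplit γ A]; ring
        _ ≤ ((1 / 2) ^ (-γ) * decay γ d) * (decay (p - γ) B * decay γ B) := by
            exact mul_le_mul h1 (mul_le_mul_of_nonneg_right h3 (decay_nonneg _ _))
              (mul_nonneg (decay_nonneg _ _) (decay_nonneg _ _)) hconst
        _ = ((1 / 2) ^ (-γ) * decay γ d) * decay p B := by rw [hsplit γ B]; ring
        _ ≤ _ := by gcongr; linarith
  calc _ ≤ ∫⁻ t : ℝ, ENNReal.ofReal ((1 / 2) ^ (-γ) * decay γ d) *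
        (ENNReal.ofReal (decay p (|0 + t| - x)) + ENNReal.ofReal (decay p (|c + t| - y))) := by
        refine lintegral_mono fun t => ?_
        rw [← ENNReal.ofReal_add (decay_nonneg _ _) (decay_nonneg _ _), ← ENNReal.ofReal_mul hconst,
          zero_add]
        exact ENNReal.ofReal_le_ofReal (hpt t)
    _ ≤ ENNReal.ofReal ((1 / 2) ^ (-γ) * decay γ d) * (ENNReal.ofReal K + ENNReal.ofReal K) := by
        rw [lintegral_const_mul _ (by fun_prop), lintegral_add_left (by fun_prop)]
        gcongr
        · exact hKb x 0
        · exact hKb y c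
    _ = _ := by
        rw [← ENNReal.ofReal_add hK.le hK.le, ← ENNReal.ofReal_mul hconst]
        congr 1; ring

/-- The angular integral of a weight which decays in `√m |sin ((θ - β) / 2)|`. -/
lemma lintegral_sin_decay_le {γ : ℝ} (hγ : 1 / 2 < γ) :
    ∃ C : ℝ, 0 < C ∧ ∀ m β : ℝ, 0 < m →
      ∫⁻ θ in Set.Ioo (-π) π, ENNReal.ofReal (decay γ (m * sin ((θ - β) / 2) ^ 2)) ≤
        ENNReal.ofReal (C / √m) := by
  set K := ∫ t : ℝ, decay (2 * γ) t with hK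
  have hK0 : 0 ≤ K := integral_nonneg (decay_nonneg _)
  have hInt : Integrable (decay (2 * γ)) := integrable_decay (by linarith)
  refine ⟨(1 / 2) ^ (-γ) * (π * (K + 1)), by positivity, fun m β hm => ?_⟩
  set g : ℝ → ℝ := fun θ => decay γ (m * sin (θ / 2) ^ 2) with hg
  have hgc : Continuous g := by rw [hg]; fun_prop
  have hper : Function.Periodic g (2 * π) := by
    intro θ
    simp only [hg]
    rw [show (θ + 2 * π) / 2 = θ / 2 + π by ring, sin_add_pi, neg_sq]
  set a := √m / π with ha
  have ha0 : 0 < a := by positivity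
  have hle : ∀ θ ∈ Set.Icc (-π) π, g θ ≤ (1 / 2) ^ (-γ) * decay (2 * γ) (a * θ) := by
    intro θ hθ
    have hs : θ ^ 2 / π ^ 2 ≤ sin (θ / 2) ^ 2 := by
      have h1 : |θ / 2| ≤ π / 2 := by
        rw [abs_le]; constructor <;> linarith [hθ.1, hθ.2]
      have h2 := mul_abs_le_abs_sin h1
      have h3 : (2 / π * |θ / 2|) ^ 2 ≤ |sin (θ / 2)| ^ 2 := by gcongr
      rw [mul_pow, sq_abs, sq_abs] at h3
      calc _ = (2 / π) ^ 2 * (θ / 2) ^ 2 := by ring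
        _ ≤ _ := h3
    have h2 : 1 / 2 * (1 + |a * θ|) ^ 2 ≤ 1 + m * sin (θ / 2) ^ 2 := by
      have : (a * θ) ^ 2 ≤ m * sin (θ / 2) ^ 2 := by
        rw [ha, mul_pow, div_pow, sq_sqrt hm.le]
        calc m / π ^ 2 * θ ^ 2 = m * (θ ^ 2 / π ^ 2) := by ring
          _ ≤ _ := by gcongr
      nlinarith [sq_nonneg (1 - |a * θ|), sq_abs (a * θ)]
    simp only [hg, decay]
    rw [abs_of_nonneg (a := m * sin (θ / 2) ^ 2) (by positivity)]
    calc (1 + m * sin (θ / 2) ^ 2) ^ (-γ) ≤ (1 / 2 * (1 + |a * θ|) ^ 2) ^ (-γ) :=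
          rpow_le_rpow_of_nonpos (by positivity) h2 (by linarith)
      _ = _ := by
          rw [mul_rpow (by norm_num) (by positivity), ← rpow_natCast, ← rpow_mul (by positivity)]
          congr 2; push_cast; ring
  have hpi : -π ≤ π := by linarith [pi_pos]
  have e1 : ∫⁻ θ in Set.Ioo (-π) π, ENNReal.ofReal (decay γ (m * sin ((θ - β) / 2) ^ 2)) =
      ENNReal.ofReal (∫ θ in (-π)..π, g θ) := by
    have : ∫ θ in (-π)..π, g (θ - β) = ∫ θ in (-π)..π, g θ := by
      rw [intervalIntegral.integral_comp_sub_right g]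
      have := hper.intervalIntegral_add_eq (-π - β) (-π)
      rw [show -π - β + 2 * π = π - β by ring, show -π + 2 * π = π by ring] at this
      exact this
    rw [← this, intervalIntegral.integral_of_le hpi, integral_Ioc_eq_integral_Ioo,
      ofReal_integral_eq_lintegral_ofReal]
    · exact ((hgc.comp (by fun_prop : Continuous fun θ => θ - β)).integrableOn_Icc
        (a := -π) (b := π)).mono_set Set.Ioo_subset_Icc_self
    · exact Filter.Eventually.of_forall fun θ => decay_nonneg _ _
  rw [e1]
  refine ENNReal.ofReal_le_ofReal ?_
  have hInt2 : Integrable fun θ => (1 / 2 : ℝ) ^ (-γ) * decay (2 * γ) (a * θ) :=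
    (hInt.comp_mul_left' ha0.ne').const_mul _
  calc ∫ θ in (-π)..π, g θ ≤ ∫ θ in (-π)..π, (1 / 2 : ℝ) ^ (-γ) * decay (2 * γ) (a * θ) :=
        intervalIntegral.integral_mono_on hpi (hgc.intervalIntegrable _ _)
          hInt2.intervalIntegrable hle
    _ ≤ ∫ θ, (1 / 2 : ℝ) ^ (-γ) * decay (2 * γ) (a * θ) := by
        rw [intervalIntegral.integral_of_le hpi]
        exact setIntegral_le_integral hInt2
          (Filter.Eventually.of_forall fun θ => mul_nonneg (by positivity) (decay_nonneg _ _))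
    _ = (1 / 2) ^ (-γ) * (π * K) / √m := by
        rw [integral_const_mul, Measure.integral_comp_mul_left (decay (2 * γ)) a, abs_of_pos
          (by positivity), ← hK, ha, smul_eq_mul]
        field_simp
    _ ≤ _ := by gcongr; linarith

/-- Distance, in angular variables, between a level set of `ψ ↦ |X + η|` and a given point. -/
lemma exists_angle_le_abs_sub_sqrt {ρ M c : ℝ} (hρ : 0 < ρ) (hM : 0 < M) (hc : 0 ≤ c) :
    ∃ θ₀ : ℝ, ∀ ψ : ℝ, 2 * (ρ * M / (ρ + M)) *
      (|sin ((ψ - θ₀) / 2)| * |sin ((ψ + θ₀) / 2)|) ≤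
        |c - √(ρ ^ 2 + M ^ 2 + 2 * ρ * M * cos ψ)| := by
  set c' := min c (ρ + M) with hc'
  have hc0 : 0 ≤ c' := le_min hc (by positivity)
  have hc1 : c' ≤ ρ + M := min_le_right _ _
  set t := (c' ^ 2 - ρ ^ 2 - M ^ 2) / (2 * ρ * M) with ht
  have ht1 : t ≤ 1 := by
    rw [ht, div_le_one (by positivity)]; nlinarith
  have hteq : 2 * ρ * M * t = c' ^ 2 - ρ ^ 2 - M ^ 2 := by
    rw [ht]; field_simp
  set t₀ := max t (-1) with ht0
  refine ⟨arccos t₀, fun ψ => ?_⟩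
  have hcos : cos (arccos t₀) = t₀ := cos_arccos (le_max_right _ _) (max_le ht1 (by norm_num))
  have hprod : 2 * (|sin ((ψ - arccos t₀) / 2)| * |sin ((ψ + arccos t₀) / 2)|) =
      |cos ψ - t₀| := by
    rw [← hcos, cos_sub_cos, hcos, abs_mul, abs_mul, abs_neg, abs_two]; ring
  have hx := neg_one_le_cos ψ
  have hx1 := cos_le_one ψ
  set x := cos ψ with hxdef
  have hle : |x - t₀| ≤ |x - t| := by
    rcases max_cases t (-1) with ⟨h, -⟩ | ⟨h, h'⟩
    · rw [ht0, h]
    · rw [ht0, h, abs_of_nonneg (by linarith), abs_of_nonneg (by linarith)]; linarith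
  have hrad : 0 ≤ ρ ^ 2 + M ^ 2 + 2 * ρ * M * x := by
    nlinarith [mul_pos hρ hM, sq_nonneg (ρ - M)]
  set φ := √(ρ ^ 2 + M ^ 2 + 2 * ρ * M * x) with hφ
  have hφ0 : 0 ≤ φ := sqrt_nonneg _
  have hφsq : φ ^ 2 = ρ ^ 2 + M ^ 2 + 2 * ρ * M * x := sq_sqrt hrad
  have hφ1 : φ ≤ ρ + M := by
    apply abs_le_of_sq_le_sq' _ (by positivity) |>.2
    nlinarith [mul_pos hρ hM]
  have hcc : |c' - φ| ≤ |c - φ| := by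
    rcases min_cases c (ρ + M) with ⟨h, -⟩ | ⟨h, h'⟩
    · rw [hc', h]
    · rw [hc', h, abs_of_nonneg (by linarith), abs_of_nonneg (by linarith)]; linarith
  have hfac : 2 * ρ * M * |x - t| ≤ 2 * (ρ + M) * |c' - φ| := by
    have : 2 * ρ * M * (x - t) = -((c' + φ) * (c' - φ)) := by
      have := hteq
      have := hφsq
      linarith [mul_sub (2 * ρ * M) x t, sq_sub_sq c' φ]
    have h2 : 2 * ρ * M * |x - t| = (c' + φ) * |c' - φ| := by
      have h3 : |2 * ρ * M * (x - t)| = |(c' + φ) * (c' - φ)| := by rw [this, abs_neg]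
      rwa [abs_mul (2 * ρ * M), abs_mul (c' + φ), abs_of_pos (by positivity : 0 < 2 * ρ * M),
        abs_of_nonneg (by positivity : 0 ≤ c' + φ)] at h3
    rw [h2]
    gcongr
    linarith
  have hs : 0 < ρ + M := by positivity
  calc _ = ρ * M / (ρ + M) * |x - t₀| := by rw [← hprod]; ring
    _ ≤ ρ * M / (ρ + M) * |x - t| := by gcongr
    _ ≤ |c' - φ| := by
        rw [div_mul_eq_mul_div, div_le_iff₀ hs]; linarith
    _ ≤ _ := hcc

lemma decay_le_add_of_or {γ m k z x y : ℝ} (hγ : 0 ≤ γ) (hk : 0 < k) (hm : 0 ≤ m)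
    (h : k * (1 + m * x ^ 2) ≤ 1 + |z| ∨ k * (1 + m * y ^ 2) ≤ 1 + |z|) :
    decay γ z ≤ k ^ (-γ) * (decay γ (m * x ^ 2) + decay γ (m * y ^ 2)) := by
  have hk' : 0 < k ^ (-γ) := by positivity
  have key : ∀ w, k * (1 + m * w ^ 2) ≤ 1 + |z| → decay γ z ≤ k ^ (-γ) * decay γ (m * w ^ 2) :=
    fun w hw => decay_le_of_mul_le hγ hk (by rwa [abs_of_nonneg (by positivity)])
  have hx := decay_nonneg γ (m * x ^ 2)
  have hy := decay_nonneg γ (m * y ^ 2)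
  rcases h with h | h
  · exact (key x h).trans (by gcongr; linarith)
  · exact (key y h).trans (by gcongr; linarith)

lemma lintegral_two_sin_decay_le {γ : ℝ} (hγ : 1 / 2 < γ) :
    ∃ C : ℝ, 0 < C ∧ ∀ k m β β' : ℝ, 0 < m → 0 < k →
      ∫⁻ θ in Set.Ioo (-π) π, ENNReal.ofReal (k ^ (-γ) * (decay γ (m * sin ((θ - β) / 2) ^ 2) +
        decay γ (m * sin ((θ - β') / 2) ^ 2))) ≤ ENNReal.ofReal (k ^ (-γ) * (C / √m)) := by
  obtain ⟨C, hC, h⟩ := lintegral_sin_decay_le hγ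
  refine ⟨C + C, by linarith, fun k m β β' hm hk => ?_⟩
  have hk' : 0 ≤ k ^ (-γ) := by positivity
  simp_rw [ENNReal.ofReal_mul hk', ENNReal.ofReal_add (decay_nonneg _ _) (decay_nonneg _ _)]
  rw [lintegral_const_mul _ (by fun_prop), lintegral_add_left (by fun_prop), add_div,
    ENNReal.ofReal_add (by positivity) (by positivity)]
  gcongr
  · exact h m β hm
  · exact h m β' hm

/-- Angular integral of the modulation weight on circles of radius at most `2 M`. -/
lemma lintegral_angle_decay_le {γ : ℝ} (hγ : 1 / 2 < γ) :
    ∃ C : ℝ, 0 < C ∧ ∀ ρ M c α : ℝ, 0 < ρ → ρ ≤ 2 * M → 0 ≤ c →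
      ∫⁻ θ in Set.Ioo (-π) π, ENNReal.ofReal
        (decay γ (c - √(ρ ^ 2 + M ^ 2 + 2 * ρ * M * cos (θ - α)))) ≤
        ENNReal.ofReal (C / √ρ) := by
  obtain ⟨C, hC, h⟩ := lintegral_two_sin_decay_le hγ
  refine ⟨(1 / 2) ^ (-γ) * C, by positivity, fun ρ M c α hρ hM hc => ?_⟩
  have hM0 : 0 < M := by linarith
  obtain ⟨θ₀, hθ₀⟩ := exists_angle_le_abs_sub_sqrt hρ hM0 hc
  refine le_trans (lintegral_mono fun θ => ENNReal.ofReal_le_ofReal ?_)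
    ((h (1 / 2) ρ (α + θ₀) (α - θ₀) hρ (by norm_num)).trans (le_of_eq (by rw [mul_div_assoc])))
  apply decay_le_add_of_or (by linarith) (by norm_num) hρ.le
  have hp := hθ₀ (θ - α)
  rw [show θ - (α + θ₀) = θ - α - θ₀ by ring, show θ - (α - θ₀) = θ - α + θ₀ by ring]
  set z := c - √(ρ ^ 2 + M ^ 2 + 2 * ρ * M * cos (θ - α))
  set s₁ := sin ((θ - α - θ₀) / 2)
  set s₂ := sin ((θ - α + θ₀) / 2)
  have hw : ρ / 3 ≤ ρ * M / (ρ + M) := by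
    rw [div_le_div_iff₀ (by norm_num) (by positivity)]; nlinarith
  have h0 : ρ / 2 * (|s₁| * |s₂|) ≤ |z| := by
    refine le_trans ?_ hp
    gcongr
    linarith
  rcases le_total |s₁| |s₂| with hs | hs
  · left
    have : s₁ ^ 2 ≤ |s₁| * |s₂| := by nlinarith [sq_abs s₁, abs_nonneg s₁]
    nlinarith
  · right
    have : s₂ ^ 2 ≤ |s₁| * |s₂| := by nlinarith [sq_abs s₂, abs_nonneg s₂]
    nlinarith

/-- Angular integral of the modulation weight on large circles, away from the directions
parallel to the low frequency. -/
lemma lintegral_angle_decay_transversal_le {γ : ℝ} (hγ : 1 / 2 < γ) :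
    ∃ C : ℝ, 0 < C ∧ ∀ ρ M c α : ℝ, 1 ≤ M → 2 * M ≤ ρ → 0 ≤ c →
      ∫⁻ θ in Set.Ioo (-π) π ∩ {θ | 8 * (1 + ρ) ^ 2 *
          (1 + |c - √(ρ ^ 2 + M ^ 2 + 2 * ρ * M * cos (θ - α))|) ≤
            (1 + M) ^ 3 * sin (θ - α) ^ 2}, ENNReal.ofReal
        (decay γ (c - √(ρ ^ 2 + M ^ 2 + 2 * ρ * M * cos (θ - α)))) ≤
        ENNReal.ofReal (C * √M / ρ) := by
  obtain ⟨C, hC, h⟩ := lintegral_two_sin_decay_le hγ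
  refine ⟨(1 / 2) ^ (-γ) * (3 / 2 * C), by positivity, fun ρ M c α hM hρM hc => ?_⟩
  have hM0 : 0 < M := by linarith
  have hρ : 0 < ρ := by linarith
  obtain ⟨θ₀, hθ₀⟩ := exists_angle_le_abs_sub_sqrt hρ hM0 hc
  set m := 4 / 9 * ρ ^ 2 / M with hm
  have hm0 : 0 < m := by positivity
  have hsq : √m = 2 / 3 * ρ / √M := by
    rw [hm, sqrt_div (by positivity), show 4 / 9 * ρ ^ 2 = (2 / 3 * ρ) ^ 2 by ring,
      sqrt_sq (by positivity)]
  have hfin : ENNReal.ofReal ((1 / 2) ^ (-γ) * (C / √m)) =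
      ENNReal.ofReal ((1 / 2) ^ (-γ) * (3 / 2 * C) * √M / ρ) := by
    rw [hsq]; congr 1; field_simp
  rw [← hfin]
  refine le_trans (setLIntegral_mono_ae (by fun_prop) (Filter.Eventually.of_forall
    fun θ hθ => ENNReal.ofReal_le_ofReal (decay_le_add_of_or (by linarith)
      (by norm_num : (0 : ℝ) < 1 / 2) hm0.le (x := sin ((θ - (α + θ₀)) / 2))
        (y := sin ((θ - (α - θ₀)) / 2)) ?_)))
    ((lintegral_mono_set Set.inter_subset_left).trans
      (h (1 / 2) m (α + θ₀) (α - θ₀) hm0 (by norm_num)))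
  have hp := hθ₀ (θ - α)
  rw [show θ - (α + θ₀) = θ - α - θ₀ by ring, show θ - (α - θ₀) = θ - α + θ₀ by ring]
  have hB := hθ.2
  simp only [Set.mem_ofPred_eq] at hB
  set z := c - √(ρ ^ 2 + M ^ 2 + 2 * ρ * M * cos (θ - α))
  set s₁ := sin ((θ - α - θ₀) / 2) with hs1
  set s₂ := sin ((θ - α + θ₀) / 2) with hs2
  set s := sin (θ - α) with hs
  have hsum : |s| ≤ |s₁| + |s₂| := by
    have e : s = s₁ * cos ((θ - α + θ₀) / 2) + cos ((θ - α - θ₀) / 2) * s₂ := by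
      rw [hs, hs1, hs2, ← sin_add]; congr 1; ring
    rw [e]
    refine (abs_add_le _ _).trans ?_
    rw [abs_mul, abs_mul]
    have a1 := abs_cos_le_one ((θ - α + θ₀) / 2)
    have a2 := abs_cos_le_one ((θ - α - θ₀) / 2)
    gcongr
    · exact mul_le_of_le_one_right (abs_nonneg _) a1
    · exact mul_le_of_le_one_left (abs_nonneg _) a2
  have hw : 2 / 3 * M ≤ ρ * M / (ρ + M) := by
    rw [le_div_iff₀ (by positivity)]; nlinarith
  have h0 : 4 / 3 * M * (|s₁| * |s₂|) ≤ |z| := by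
    refine le_trans (mul_le_mul_of_nonneg_right ?_ (by positivity)) hp
    linarith
  set L := 1 + |z| with hL
  have hL1 : 1 ≤ L := by linarith [abs_nonneg z]
  have hB' : ρ ^ 2 * L ≤ M ^ 3 * s ^ 2 := by
    have h1 : (1 + M) ^ 3 ≤ (2 * M) ^ 3 := by gcongr; linarith
    have h2 : 8 * ρ ^ 2 * L ≤ 8 * (1 + ρ) ^ 2 * L := by gcongr; linarith
    nlinarith [mul_le_mul_of_nonneg_right h1 (sq_nonneg s)]
  have fin : ∀ w : ℝ, 0 ≤ |w| → 2 / 3 * M * |w| * |s| ≤ L →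
      1 / 2 * (1 + m * w ^ 2) ≤ L := by
    intro w hw0 hw
    have h3 : (2 / 3 * M * |w| * |s|) ^ 2 ≤ L ^ 2 := by gcongr
    have h4 : 4 / 9 * w ^ 2 * (ρ ^ 2 * L) ≤ M * L ^ 2 := by
      calc _ ≤ 4 / 9 * w ^ 2 * (M ^ 3 * s ^ 2) := by gcongr
        _ = M * (2 / 3 * M * |w| * |s|) ^ 2 := by
            simp only [mul_pow, sq_abs]; ring
        _ ≤ _ := by gcongr
    have h5 : 4 / 9 * w ^ 2 * ρ ^ 2 ≤ M * L := by
      have : (4 / 9 * w ^ 2 * ρ ^ 2) * L ≤ (M * L) * L := by linarith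
      exact le_of_mul_le_mul_right this (by linarith)
    have h6 : m * w ^ 2 ≤ L := by
      rw [hm, div_mul_eq_mul_div, div_le_iff₀ hM0]; linarith
    linarith
  rcases le_total |s₁| |s₂| with hs' | hs'
  · left
    refine fin s₁ (abs_nonneg _) ?_
    have : |s₁| * |s| ≤ |s₁| * (2 * |s₂|) := by gcongr; linarith
    nlinarith
  · right
    refine fin s₂ (abs_nonneg _) ?_
    have : |s₂| * |s| ≤ |s₂| * (2 * |s₁|) := by gcongr; linarith
    nlinarith

/-- Angular measure of the directions almost parallel to a given one. -/
lemma volume_angle_parallel_le :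
    ∃ C : ℝ, 0 < C ∧ ∀ κ α : ℝ, 0 < κ →
      volume (Set.Ioo (-π) π ∩ {θ | sin (θ - α) ^ 2 ≤ κ ^ 2}) ≤ ENNReal.ofReal (C * κ) := by
  obtain ⟨C, hC, h⟩ := lintegral_two_sin_decay_le (γ := 1) (by norm_num)
  refine ⟨2 * C, by positivity, fun κ α hκ => ?_⟩
  set S : Set ℝ := {θ | sin (θ - α) ^ 2 ≤ κ ^ 2}
  have hsq : √((1 / κ) ^ 2) = 1 / κ := sqrt_sq (by positivity)
  have hh := h (1 / 2) ((1 / κ) ^ 2) α (α - π) (by positivity) (by norm_num)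
  rw [hsq, show ((1 / 2 : ℝ) ^ (-1 : ℝ) * (C / (1 / κ))) = 2 * C * κ by
    rw [rpow_neg_one]; field_simp] at hh
  refine le_trans ?_ ((lintegral_mono_set (Set.inter_subset_left (t := S))).trans hh)
  rw [← setLIntegral_one]
  refine setLIntegral_mono_ae (by fun_prop) (Filter.Eventually.of_forall fun θ hθ => ?_)
  rw [← ENNReal.ofReal_one]
  refine ENNReal.ofReal_le_ofReal ?_
  have e0 : decay 1 0 = 1 := by simp [decay]
  refine e0.symm.le.trans (decay_le_add_of_or (γ := 1) (k := 1 / 2) (m := (1 / κ) ^ 2)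
    (by norm_num) (by norm_num) (by positivity) ?_)
  have hS : sin (θ - α) ^ 2 ≤ κ ^ 2 := hθ.2
  have e1 : sin ((θ - (α - π)) / 2) = cos ((θ - α) / 2) := by
    rw [show (θ - (α - π)) / 2 = (θ - α) / 2 + π / 2 by ring, sin_add_pi_div_two]
  rw [e1]
  have e2 : sin (θ - α) = 2 * sin ((θ - α) / 2) * cos ((θ - α) / 2) := by
    rw [← sin_two_mul]; congr 1; ring
  have e3 := sin_sq_add_cos_sq ((θ - α) / 2)
  rw [e2] at hS
  set a := sin ((θ - α) / 2)
  set b := cos ((θ - α) / 2)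
  have hab : 4 * (a ^ 2 * b ^ 2) ≤ κ ^ 2 := by nlinarith
  have fin : ∀ w : ℝ, w ^ 2 ≤ κ ^ 2 → 1 / 2 * (1 + (1 / κ) ^ 2 * w ^ 2) ≤ 1 + |(0 : ℝ)| := by
    intro w hw
    have : (1 / κ) ^ 2 * w ^ 2 ≤ 1 := by
      rw [div_pow, one_pow, div_mul_eq_mul_div, one_mul, div_le_one (by positivity)]; exact hw
    rw [abs_zero]; linarith
  rcases le_total (a ^ 2) (b ^ 2) with hs | hs
  · exact Or.inl (fin a (by nlinarith [sq_nonneg a]))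
  · exact Or.inr (fin b (by nlinarith [sq_nonneg b]))

/-- The Euclidean norm on `ℝ × ℝ`. -/
def nrm (p : ℝ × ℝ) : ℝ := √(p.1 ^ 2 + p.2 ^ 2)

/-- The scalar cross product on `ℝ × ℝ`. -/
def cross (p q : ℝ × ℝ) : ℝ := p.1 * q.2 - p.2 * q.1

lemma nrm_nonneg (p : ℝ × ℝ) : 0 ≤ nrm p := sqrt_nonneg _

@[fun_prop]
lemma continuous_nrm : Continuous nrm := by unfold nrm; fun_prop

@[fun_prop]
lemma measurable_nrm : Measurable nrm := continuous_nrm.measurable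

lemma nrm_eq_norm (p : ℝ × ℝ) : nrm p = ‖(⟨p.1, p.2⟩ : ℂ)‖ := by
  rw [Complex.norm_eq_sqrt_sq_add_sq]; rfl

lemma nrm_add_le (p q : ℝ × ℝ) : nrm (p + q) ≤ nrm p + nrm q := by
  simp only [nrm_eq_norm]
  exact norm_add_le (⟨p.1, p.2⟩ : ℂ) ⟨q.1, q.2⟩

lemma nrm_neg (p : ℝ × ℝ) : nrm (-p) = nrm p := by simp [nrm]

lemma nrm_polar {ρ : ℝ} (hρ : 0 ≤ ρ) (θ : ℝ) : nrm (ρ * cos θ, ρ * sin θ) = ρ := by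
  have : (ρ * cos θ) ^ 2 + (ρ * sin θ) ^ 2 = ρ ^ 2 := by
    linear_combination ρ ^ 2 * sin_sq_add_cos_sq θ
  simp only [nrm, this, sqrt_sq hρ]

lemma exists_polar (X : ℝ × ℝ) : ∃ α, X = (nrm X * cos α, nrm X * sin α) := by
  refine ⟨Complex.arg ⟨X.1, X.2⟩, ?_⟩
  rw [nrm_eq_norm, Complex.norm_mul_cos_arg, Complex.norm_mul_sin_arg]

lemma nrm_add_polar (M α ρ θ : ℝ) :
    nrm ((M * cos α, M * sin α) + (ρ * cos θ, ρ * sin θ)) =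
      √(ρ ^ 2 + M ^ 2 + 2 * ρ * M * cos (θ - α)) := by
  unfold nrm
  congr 1
  rw [cos_sub]
  simp only [Prod.fst_add, Prod.snd_add]
  linear_combination M ^ 2 * sin_sq_add_cos_sq α + ρ ^ 2 * sin_sq_add_cos_sq θ

lemma cross_polar (M α ρ θ : ℝ) :
    cross (M * cos α, M * sin α) (ρ * cos θ, ρ * sin θ) = M * ρ * sin (θ - α) := by
  unfold cross
  rw [sin_sub]; ring

lemma lintegral_le_of_polar {f : ℝ × ℝ → ENNReal} (hf : Measurable f) {G : ℝ → ENNReal}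
    (h : ∀ ρ, 0 < ρ → ∫⁻ θ in Set.Ioo (-π) π, f (ρ * cos θ, ρ * sin θ) ≤ G ρ) :
    ∫⁻ p, f p ≤ ∫⁻ ρ in Set.Ioi (0 : ℝ), ENNReal.ofReal ρ * G ρ := by
  have hm : Measurable fun p : ℝ × ℝ => f (p.1 * cos p.2, p.1 * sin p.2) := by fun_prop
  rw [← lintegral_comp_polarCoord_symm, polarCoord_target, Measure.volume_eq_prod,
    ← Measure.prod_restrict, lintegral_prod]
  · refine setLIntegral_mono' measurableSet_Ioi fun ρ hρ => ?_
    simp only [polarCoord_symm_apply, smul_eq_mul]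
    rw [lintegral_const_mul _ (by fun_prop)]
    gcongr
    exact h ρ hρ
  · simp only [polarCoord_symm_apply, smul_eq_mul]
    fun_prop

lemma lintegral_Ioc_one_add_rpow_le {q R : ℝ} (hq : -1 < q) (hR : 0 ≤ R) :
    ∫⁻ ρ in Set.Ioc 0 R, ENNReal.ofReal ((1 + ρ) ^ q) ≤
      ENNReal.ofReal ((1 + R) ^ (q + 1) / (q + 1)) := by
  have hcont : ContinuousOn (fun ρ : ℝ => (1 + ρ) ^ q) (Set.Icc 0 R) :=
    (by fun_prop : ContinuousOn (fun ρ : ℝ => 1 + ρ) (Set.Icc 0 R)).rpow_const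
      fun x hx => Or.inl (by linarith [hx.1])
  rw [← ofReal_integral_eq_lintegral_ofReal]
  · rw [← intervalIntegral.integral_of_le hR]
    refine ENNReal.ofReal_le_ofReal ?_
    have : ∫ ρ in (0 : ℝ)..R, (1 + ρ) ^ q = ∫ ρ in (1 + 0 : ℝ)..(1 + R), ρ ^ q :=
      intervalIntegral.integral_comp_add_left (fun ρ => ρ ^ q) 1
    rw [this, integral_rpow (Or.inl hq)]
    have : 0 < q + 1 := by linarith
    gcongr
    simp
  · exact hcont.integrableOn_Icc.mono_set Set.Ioc_subset_Icc_self
  · refine (ae_restrict_mem measurableSet_Ioc).mono fun x hx => ?_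
    have : 0 ≤ 1 + x := by linarith [hx.1]
    exact rpow_nonneg this _

lemma lintegral_Ioi_one_add_rpow_le {q R : ℝ} (hq : q < -1) (hR : 0 ≤ R) :
    ∫⁻ ρ in Set.Ioi R, ENNReal.ofReal ((1 + ρ) ^ q) ≤
      ENNReal.ofReal ((1 + R) ^ (q + 1) / (-(q + 1))) := by
  have e : ∫⁻ ρ in Set.Ioi R, ENNReal.ofReal ((1 + ρ) ^ q) =
      ∫⁻ ρ in Set.Ioi (1 + R), ENNReal.ofReal (ρ ^ q) := by
    have := (measurePreserving_add_left volume (1 : ℝ)).setLIntegral_comp_preimage_emb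
      (measurableEmbedding_addLeft 1) (fun ρ => ENNReal.ofReal (ρ ^ q)) (Set.Ioi (1 + R))
    rw [← this]
    congr 2
    ext x; simp
  rw [e, ← ofReal_integral_eq_lintegral_ofReal]
  · rw [integral_Ioi_rpow_of_lt hq (by linarith)]
    refine ENNReal.ofReal_le_ofReal (le_of_eq ?_)
    rw [div_neg, neg_div]
  · exact integrableOn_Ioi_rpow_of_lt hq (by linarith)
  · refine (ae_restrict_mem measurableSet_Ioi).mono fun x hx => ?_
    have : 0 ≤ x := by linarith [Set.mem_Ioi.1 hx]
    exact rpow_nonneg this _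

lemma decay_of_nonneg {p x : ℝ} (hx : 0 ≤ x) : decay p x = (1 + x) ^ (-p) := by
  rw [decay, abs_of_nonneg hx]

/-- Integral of the modulation weight over a disc of radius `2 |X|`. -/
lemma lintegral_disc_decay_le {κ γ : ℝ} (hκ : κ < 3 / 2) (hγ : 1 / 2 < γ) :
    ∃ C : ℝ, 0 < C ∧ ∀ (X : ℝ × ℝ) (c : ℝ → ℝ), Measurable c → (∀ ρ, 0 ≤ c ρ) →
      ∫⁻ η in {η | nrm η ≤ 2 * nrm X}, ENNReal.ofReal
        (decay κ (nrm η) * decay γ (c (nrm η) - nrm (X + η))) ≤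
      ENNReal.ofReal (C * (1 + nrm X) ^ (3 / 2 - κ)) := by
  obtain ⟨C, hC, h⟩ := lintegral_angle_decay_le hγ
  have h32 : 0 < 3 / 2 - κ := by linarith
  refine ⟨C * (2 ^ (3 / 2 - κ) / (3 / 2 - κ)), by positivity, fun X c hc hc0 => ?_⟩
  set M := nrm X with hM
  have hM0 : 0 ≤ M := nrm_nonneg X
  obtain ⟨α, hα⟩ := exists_polar X
  have hS : MeasurableSet {η | nrm η ≤ 2 * M} := measurableSet_le (by fun_prop) (by fun_prop)
  rw [← lintegral_indicator hS]
  refine (lintegral_le_of_polar (G := (Set.Iic (2 * M)).indicator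
    fun ρ => ENNReal.ofReal (decay κ ρ * (C / √ρ))) ?_ ?_).trans ?_
  · refine Measurable.indicator ?_ hS
    fun_prop
  · intro ρ hρ
    by_cases hρM : ρ ≤ 2 * M
    · rw [Set.indicator_of_mem (by exact hρM), ENNReal.ofReal_mul (decay_nonneg _ _)]
      calc _ ≤ ∫⁻ θ in Set.Ioo (-π) π, ENNReal.ofReal (decay κ ρ) * ENNReal.ofReal
              (decay γ (c ρ - √(ρ ^ 2 + M ^ 2 + 2 * ρ * M * cos (θ - α)))) := by
            refine lintegral_mono fun θ => (Set.indicator_le_self _ _ _).trans ?_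
            rw [nrm_polar hρ.le, hα, ← hM, nrm_add_polar, ENNReal.ofReal_mul (decay_nonneg _ _)]
        _ ≤ _ := by
            rw [lintegral_const_mul _ (by fun_prop)]
            gcongr
            exact h ρ M (c ρ) α hρ hρM (hc0 ρ)
    · rw [Set.indicator_of_notMem (by exact hρM)]
      refine le_of_eq ?_
      rw [lintegral_eq_zero_iff']
      · refine Filter.Eventually.of_forall fun θ => ?_
        refine Set.indicator_of_notMem ?_ _
        simpa [nrm_polar hρ.le] using hρM
      · refine Measurable.aemeasurable ?_
        refine (Measurable.indicator ?_ hS).comp (by fun_prop : Measurable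
          fun θ : ℝ => (ρ * cos θ, ρ * sin θ))
        fun_prop
  · calc _ = ∫⁻ ρ in Set.Ioi (0 : ℝ), (Set.Iic (2 * M)).indicator
            (fun ρ => ENNReal.ofReal ρ * ENNReal.ofReal (decay κ ρ * (C / √ρ))) ρ := by
          congr 1; ext ρ
          by_cases hρM : ρ ∈ Set.Iic (2 * M) <;> simp [hρM]
      _ = ∫⁻ ρ in Set.Ioc 0 (2 * M),
            ENNReal.ofReal ρ * ENNReal.ofReal (decay κ ρ * (C / √ρ)) := by
          rw [lintegral_indicator measurableSet_Iic, Measure.restrict_restrict measurableSet_Iic,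
            Set.Iic_inter_Ioi]
      _ ≤ ∫⁻ ρ in Set.Ioc 0 (2 * M),
            ENNReal.ofReal C * ENNReal.ofReal ((1 + ρ) ^ (1 / 2 - κ)) := by
          refine setLIntegral_mono' measurableSet_Ioc fun ρ hρ => ?_
          rw [← ENNReal.ofReal_mul hρ.1.le, ← ENNReal.ofReal_mul hC.le]
          refine ENNReal.ofReal_le_ofReal ?_
          have h1 : 0 < 1 + ρ := by linarith [hρ.1]
          have e : ρ * (decay κ ρ * (C / √ρ)) = C * (√ρ * decay κ ρ) := by
            have := sq_sqrt hρ.1.le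
            have h2 : √ρ ≠ 0 := (sqrt_pos.2 hρ.1).ne'
            field_simp
            linear_combination -decay κ ρ * this
          rw [e, decay_of_nonneg hρ.1.le, sub_eq_add_neg, rpow_add h1, ← sqrt_eq_rpow]
          gcongr
          linarith
      _ ≤ ENNReal.ofReal C *
            ENNReal.ofReal ((1 + 2 * M) ^ (1 / 2 - κ + 1) / (1 / 2 - κ + 1)) := by
          rw [lintegral_const_mul' _ _ ENNReal.ofReal_ne_top]
          gcongr
          exact lintegral_Ioc_one_add_rpow_le (by linarith) (by linarith)
      _ ≤ _ := by
          rw [← ENNReal.ofReal_mul hC.le]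
          refine ENNReal.ofReal_le_ofReal ?_
          rw [show 1 / 2 - κ + 1 = 3 / 2 - κ by ring]
          have : (1 + 2 * M) ^ (3 / 2 - κ) ≤ (2 * (1 + M)) ^ (3 / 2 - κ) :=
            rpow_le_rpow (by positivity) (by linarith) h32.le
          rw [mul_rpow (by norm_num) (by positivity)] at this
          calc _ ≤ C * (2 ^ (3 / 2 - κ) * (1 + M) ^ (3 / 2 - κ) / (3 / 2 - κ)) := by gcongr
            _ = _ := by ring

lemma lintegral_modulation_pair_le {p γ : ℝ} (hp : 1 < p) (hγ : 0 < γ) (hγp : γ ≤ p) :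
    ∃ C : ℝ, 0 < C ∧ ∀ τ x y : ℝ,
      ∫⁻ t, ENNReal.ofReal (decay p (|t| - x) * decay γ (|τ + t| - y)) ≤
        ENNReal.ofReal (C * (decay γ (|τ + x| - y) + decay γ (|τ - x| - y))) ∧
      ∫⁻ t, ENNReal.ofReal (decay p (|t| - x) * decay γ (|τ + t| - y)) ≤
        ENNReal.ofReal (C * (decay γ (|τ + y| - x) + decay γ (|τ - y| - x))) := by
  obtain ⟨C, hC, h⟩ := lintegral_decay_mul_decay_le hp hγ hγp
  have key : ∀ a b : ℝ, C * decay γ (min |a| |b|) ≤ C * (decay γ a + decay γ b) := by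
    intro a b
    gcongr
    rcases min_choice |a| |b| with e | e <;> rw [e]
    · have : decay γ |a| = decay γ a := by simp [decay]
      linarith [decay_nonneg γ b]
    · have : decay γ |b| = decay γ b := by simp [decay]
      linarith [decay_nonneg γ a]
  refine ⟨C, hC, fun τ x y => ⟨?_, ?_⟩⟩
  · refine (h τ x y _ (by positivity) fun t => ?_).trans (ENNReal.ofReal_le_ofReal (key _ _))
    rcases le_total 0 t with ht | ht
    · refine (min_le_left _ _).trans ?_
      rw [abs_of_nonneg ht]
      have := abs_abs_sub_abs_le_abs_sub (τ + x) (τ + t)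
      rw [show τ + x - (τ + t) = -(t - x) by ring, abs_neg] at this
      calc |(|τ + x| - y)| = |(|τ + x| - |τ + t|) + (|τ + t| - y)| := by congr 1; ring
        _ ≤ _ := (abs_add_le _ _).trans (by linarith)
    · refine (min_le_right _ _).trans ?_
      rw [abs_of_nonpos ht]
      have := abs_abs_sub_abs_le_abs_sub (τ - x) (τ + t)
      rw [show τ - x - (τ + t) = -t - x by ring] at this
      calc |(|τ - x| - y)| = |(|τ - x| - |τ + t|) + (|τ + t| - y)| := by congr 1; ring
        _ ≤ _ := (abs_add_le _ _).trans (by linarith)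
  · refine (h τ x y _ (by positivity) fun t => ?_).trans (ENNReal.ofReal_le_ofReal (key _ _))
    rcases le_total 0 (τ + t) with ht | ht
    · refine (min_le_right _ _).trans ?_
      rw [abs_of_nonneg ht]
      have := abs_abs_sub_abs_le_abs_sub (τ - y) (-t)
      rw [show τ - y - -t = τ + t - y by ring, abs_neg] at this
      calc |(|τ - y| - x)| = |(|τ - y| - |t|) + (|t| - x)| := by congr 1; ring
        _ ≤ _ := (abs_add_le _ _).trans (by linarith)
    · refine (min_le_left _ _).trans ?_
      rw [abs_of_nonpos ht]
      have := abs_abs_sub_abs_le_abs_sub (τ + y) (-t)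
      rw [show τ + y - -t = -(-(τ + t) - y) by ring, abs_neg, abs_neg] at this
      calc |(|τ + y| - x)| = |(|τ + y| - |t|) + (|t| - x)| := by congr 1; ring
        _ ≤ _ := (abs_add_le _ _).trans (by linarith)

/-- The product of the reciprocal weights at the frequencies `(τ, X)`, `(t, η)` and
`(τ + t, X + η)`. -/
def waveKernel (α β γ p : ℝ) (τ : ℝ) (X : ℝ × ℝ) (t : ℝ) (η : ℝ × ℝ) : ℝ :=
  decay α (nrm X) * (decay α (nrm η) * decay p (|t| - nrm η)) *
    (decay β (nrm (X + η)) * decay γ (|τ + t| - nrm (X + η)))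

/-- The spatial frequency `X` is small and almost parallel to `η`, relative to the output
modulation. -/
def AlmostParallel (τ : ℝ) (X : ℝ × ℝ) (t : ℝ) (η : ℝ × ℝ) : Prop :=
  2 * nrm X ≤ nrm η ∧ (1 + nrm X) ^ 3 * cross X η ^ 2 ≤
    8 * (1 + nrm η) ^ 2 * (nrm X ^ 2 * nrm η ^ 2) * (1 + |(|τ + t| - nrm (X + η))|)

lemma decay_half_le {p x y : ℝ} (hp : 0 ≤ p) (hx : 0 ≤ x) (hxy : y ≤ 2 * x) (hy : 0 ≤ y) :
    decay p x ≤ 2 ^ p * decay p y := by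
  have := decay_le_of_mul_le (p := p) (x := x) (y := y) (k := 1 / 2) hp (by norm_num)
    (by rw [abs_of_nonneg hx, abs_of_nonneg hy]; linarith)
  rwa [one_div, inv_rpow (by norm_num), rpow_neg (by norm_num), inv_inv] at this

/-- Integration in the time frequency for `|η| ≤ 2 |X|`. -/
lemma lintegral_time_waveKernel_le {α β γ p : ℝ} (hp : 1 < p) (hγ : 1 / 2 < γ) (hγp : γ ≤ p)
    (hα : 0 ≤ α) (hβ : 0 ≤ β) :
    ∃ C : ℝ, 0 < C ∧ ∀ (τ : ℝ) (X η : ℝ × ℝ), nrm η ≤ 2 * nrm X →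
      ∫⁻ t, ENNReal.ofReal (waveKernel α β γ p τ X t η) ≤
        ENNReal.ofReal (2 ^ β * C * (decay α (nrm X) * decay β (nrm X))) *
          (ENNReal.ofReal (decay α (nrm η) * decay γ (|τ + nrm η| - nrm (X + η))) +
            ENNReal.ofReal (decay α (nrm η) * decay γ (|τ - nrm η| - nrm (X + η)))) +
        {η | nrm (X + η) ≤ 2 * nrm X}.indicator (fun η =>
          ENNReal.ofReal (2 ^ α * C * (decay α (nrm X) * decay α (nrm X))) *
          (ENNReal.ofReal (decay β (nrm (X + η)) * decay γ (|τ + nrm (X + η)| - nrm η)) +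
            ENNReal.ofReal (decay β (nrm (X + η)) * decay γ (|τ - nrm (X + η)| - nrm η)))) η := by
  obtain ⟨C₁, hC₁, h₁⟩ := lintegral_modulation_pair_le hp (by linarith : 0 < γ) hγp
  refine ⟨C₁, hC₁, fun τ X η hη' => ?_⟩
  have hM0 : 0 ≤ nrm X := nrm_nonneg X
  have hd := decay_nonneg
  set M := nrm X with hM
  have e : ∀ t, ENNReal.ofReal (waveKernel α β γ p τ X t η) =
      ENNReal.ofReal (decay α M * decay α (nrm η) * decay β (nrm (X + η))) *
        ENNReal.ofReal (decay p (|t| - nrm η) * decay γ (|τ + t| - nrm (X + η))) := by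
    intro t
    rw [← ENNReal.ofReal_mul (mul_nonneg (mul_nonneg (hd _ _) (hd _ _)) (hd _ _)), waveKernel]
    congr 1; ring
  simp_rw [e]
  rw [lintegral_const_mul' _ _ ENNReal.ofReal_ne_top]
  obtain ⟨hA, hB⟩ := h₁ τ (nrm η) (nrm (X + η))
  have htri : M ≤ nrm η + nrm (X + η) := by
    have := nrm_add_le (X + η) (-η)
    rw [nrm_neg, add_neg_cancel_right] at this
    linarith
  have hηn := nrm_nonneg η
  have hXn := nrm_nonneg (X + η)
  rcases le_total (nrm η) (nrm (X + η)) with hle | hle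
  · refine le_trans ?_ le_self_add
    refine (mul_le_mul_right hA _).trans ?_
    rw [← ENNReal.ofReal_mul (mul_nonneg (mul_nonneg (hd _ _) (hd _ _)) (hd _ _)),
      ← ENNReal.ofReal_add (mul_nonneg (hd _ _) (hd _ _)) (mul_nonneg (hd _ _) (hd _ _)),
      ← ENNReal.ofReal_mul (mul_nonneg (by positivity) (mul_nonneg (hd _ _) (hd _ _)))]
    refine ENNReal.ofReal_le_ofReal ?_
    have h1 := decay_half_le hβ hXn (by linarith : M ≤ 2 * nrm (X + η)) hM0
    set D := decay γ (|τ + nrm η| - nrm (X + η)) + decay γ (|τ - nrm η| - nrm (X + η)) with hD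
    have hD0 : 0 ≤ D := add_nonneg (hd _ _) (hd _ _)
    have := hd α M
    have := hd α (nrm η)
    calc _ ≤ decay α M * decay α (nrm η) * (2 ^ β * decay β M) * (C₁ * D) := by gcongr
      _ = _ := by rw [hD]; ring
  · refine le_trans ?_ le_add_self
    rw [Set.indicator_of_mem (by exact hle.trans hη')]
    refine (mul_le_mul_right hB _).trans ?_
    rw [← ENNReal.ofReal_mul (mul_nonneg (mul_nonneg (hd _ _) (hd _ _)) (hd _ _)),
      ← ENNReal.ofReal_add (mul_nonneg (hd _ _) (hd _ _)) (mul_nonneg (hd _ _) (hd _ _)),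
      ← ENNReal.ofReal_mul (mul_nonneg (by positivity) (mul_nonneg (hd _ _) (hd _ _)))]
    refine ENNReal.ofReal_le_ofReal ?_
    have h1 := decay_half_le hα hηn (by linarith : M ≤ 2 * nrm η) hM0
    set D := decay γ (|τ + nrm (X + η)| - nrm η) + decay γ (|τ - nrm (X + η)| - nrm η) with hD
    have hD0 : 0 ≤ D := add_nonneg (hd _ _) (hd _ _)
    have := hd α M
    have := hd β (nrm (X + η))
    calc _ ≤ decay α M * (2 ^ α * decay α M) * decay β (nrm (X + η)) * (C₁ * D) := by gcongr
      _ = _ := by rw [hD]; ring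

/-- Contribution of `|η| ≤ 2 |X|`. -/
lemma lintegral_waveKernel_disc_le {α β γ p : ℝ} (hp : 1 < p) (hγ : 1 / 2 < γ) (hγp : γ ≤ p)
    (hα : 0 ≤ α) (hα' : α < 3 / 2) (hβ : 0 ≤ β) (hβ' : β < 3 / 2) (hαβ : 3 / 2 ≤ 2 * α + β) :
    ∃ C : ℝ, 0 < C ∧ ∀ (τ : ℝ) (X : ℝ × ℝ),
      ∫⁻ η in {η | nrm η ≤ 2 * nrm X}, ∫⁻ t, ENNReal.ofReal (waveKernel α β γ p τ X t η) ≤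
        ENNReal.ofReal C := by
  obtain ⟨C₁, hC₁, h₁⟩ := lintegral_time_waveKernel_le hp hγ hγp hα hβ
  obtain ⟨C₂, hC₂, h₂⟩ := lintegral_disc_decay_le hα' hγ
  obtain ⟨C₃, hC₃, h₃⟩ := lintegral_disc_decay_le hβ' hγ
  refine ⟨2 ^ β * C₁ * (C₂ + C₂) + 2 ^ α * C₁ * (C₃ + C₃), by positivity, fun τ X => ?_⟩
  have h₁' := h₁ τ X
  obtain ⟨M, hM⟩ : ∃ M, M = nrm X := ⟨_, rfl⟩
  have hM0 : 0 ≤ M := hM ▸ nrm_nonneg X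
  simp only [← hM] at h₁' ⊢
  have hd := decay_nonneg
  have hm1 : MeasurableSet {η | nrm η ≤ 2 * M} := measurableSet_le (by fun_prop) (by fun_prop)
  have hm2 : MeasurableSet {η | nrm (X + η) ≤ 2 * M} :=
    measurableSet_le (by fun_prop) (by fun_prop)
  have hpow : ∀ a : ℝ, a ≤ 0 → (1 + M) ^ a ≤ 1 := fun a ha =>
    rpow_le_one_of_one_le_of_nonpos (by linarith) ha
  have hfirst : ∀ c : ℝ → ℝ, Measurable c → (∀ ρ, 0 ≤ c ρ) →
      ENNReal.ofReal (2 ^ β * C₁ * (decay α M * decay β M)) *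
        ∫⁻ η in {η | nrm η ≤ 2 * M},
          ENNReal.ofReal (decay α (nrm η) * decay γ (c (nrm η) - nrm (X + η))) ≤
        ENNReal.ofReal (2 ^ β * C₁ * C₂) := by
    intro c hc hc0
    have hh := h₂ X c hc hc0
    rw [← hM] at hh
    refine (mul_le_mul_right hh _).trans ?_
    rw [← ENNReal.ofReal_mul (mul_nonneg (by positivity) (mul_nonneg (hd _ _) (hd _ _)))]
    refine ENNReal.ofReal_le_ofReal ?_
    rw [decay_of_nonneg hM0, decay_of_nonneg hM0]
    have e : (1 + M) ^ (-α) * (1 + M) ^ (-β) * (1 + M) ^ (3 / 2 - α) ≤ 1 := by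
      rw [← rpow_add (by linarith), ← rpow_add (by linarith)]
      exact hpow _ (by linarith)
    calc _ = 2 ^ β * C₁ * C₂ * ((1 + M) ^ (-α) * (1 + M) ^ (-β) * (1 + M) ^ (3 / 2 - α)) := by ring
      _ ≤ 2 ^ β * C₁ * C₂ * 1 := by gcongr
      _ = _ := by ring
  have hsecond : ∀ c : ℝ → ℝ, Measurable c → (∀ ρ, 0 ≤ c ρ) →
      ENNReal.ofReal (2 ^ α * C₁ * (decay α M * decay α M)) *
        ∫⁻ η in {η | nrm (X + η) ≤ 2 * M},
          ENNReal.ofReal (decay β (nrm (X + η)) * decay γ (c (nrm (X + η)) - nrm η)) ≤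
        ENNReal.ofReal (2 ^ α * C₁ * C₃) := by
    intro c hc hc0
    have hh := h₃ (-X) c hc hc0
    rw [nrm_neg, ← hM] at hh
    have e := (measurePreserving_add_left (volume : Measure (ℝ × ℝ))
      X).setLIntegral_comp_preimage_emb
      (measurableEmbedding_addLeft X)
      (fun ξ => ENNReal.ofReal (decay β (nrm ξ) * decay γ (c (nrm ξ) - nrm (-X + ξ))))
      {ξ | nrm ξ ≤ 2 * M}
    rw [← e] at hh
    simp only [neg_add_cancel_left, Set.preimage_ofPred_eq] at hh
    refine (mul_le_mul_right hh _).trans ?_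
    rw [← ENNReal.ofReal_mul (mul_nonneg (by positivity) (mul_nonneg (hd _ _) (hd _ _)))]
    refine ENNReal.ofReal_le_ofReal ?_
    rw [decay_of_nonneg hM0]
    have e : (1 + M) ^ (-α) * (1 + M) ^ (-α) * (1 + M) ^ (3 / 2 - β) ≤ 1 := by
      rw [← rpow_add (by linarith), ← rpow_add (by linarith)]
      exact hpow _ (by linarith)
    calc _ = 2 ^ α * C₁ * C₃ * ((1 + M) ^ (-α) * (1 + M) ^ (-α) * (1 + M) ^ (3 / 2 - β)) := by ring
      _ ≤ 2 ^ α * C₁ * C₃ * 1 := by gcongr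
      _ = _ := by ring
  have hc1 : Measurable fun ρ : ℝ => |τ + ρ| := by fun_prop
  have hc2 : Measurable fun ρ : ℝ => |τ - ρ| := by fun_prop
  have hsplit : ∀ (S : Set (ℝ × ℝ)) (a : ENNReal) (f g : ℝ × ℝ → ENNReal), Measurable f →
      Measurable g → ∫⁻ η in S, a * (f η + g η) = a * (∫⁻ η in S, f η) + a * ∫⁻ η in S, g η := by
    intro S a f g hf hg
    rw [lintegral_const_mul _ (by fun_prop), lintegral_add_left hf, mul_add]
  have hmeas : ∀ (κ : ℝ) (c : ℝ → ℝ), Measurable c →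
      (Measurable fun η => ENNReal.ofReal (decay κ (nrm η) * decay γ (c (nrm η) - nrm (X + η)))) ∧
      Measurable fun η =>
        ENNReal.ofReal (decay κ (nrm (X + η)) * decay γ (c (nrm (X + η)) - nrm η)) :=
    fun κ c hc => ⟨by fun_prop, by fun_prop⟩
  refine (setLIntegral_mono' hm1 fun η hη => h₁' η hη).trans ?_
  rw [lintegral_add_left (by fun_prop),
    hsplit _ _ _ _ (hmeas α _ hc1).1 (hmeas α _ hc2).1]
  refine (add_le_add (add_le_add (hfirst _ hc1 fun _ => abs_nonneg _)
    (hfirst _ hc2 fun _ => abs_nonneg _)) ((setLIntegral_le_lintegral _ _).trans ?_)).trans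
    (le_of_eq (a := (ENNReal.ofReal (2 ^ β * C₁ * C₂) + ENNReal.ofReal (2 ^ β * C₁ * C₂)) +
      (ENNReal.ofReal (2 ^ α * C₁ * C₃) + ENNReal.ofReal (2 ^ α * C₁ * C₃))) ?_)
  · rw [lintegral_indicator hm2, hsplit _ _ _ _ (hmeas β _ hc1).2 (hmeas β _ hc2).2]
    have hs1 := hsecond (fun ρ => |τ + ρ|) hc1 fun _ => abs_nonneg _
    have hs2 := hsecond (fun ρ => |τ - ρ|) hc2 fun _ => abs_nonneg _
    exact add_le_add hs1 hs2
  · rw [← ENNReal.ofReal_add (by positivity) (by positivity),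
      ← ENNReal.ofReal_add (by positivity) (by positivity),
      ← ENNReal.ofReal_add (by positivity) (by positivity)]
    congr 1; ring

@[fun_prop]
lemma measurable_waveKernel {Ω : Type*} [MeasurableSpace Ω] (α β γ p : ℝ) {τ t : Ω → ℝ}
    {X η : Ω → ℝ × ℝ} (hτ : Measurable τ) (hX : Measurable X) (ht : Measurable t)
    (hη : Measurable η) : Measurable fun ω => waveKernel α β γ p (τ ω) (X ω) (t ω) (η ω) := by
  unfold waveKernel
  fun_prop

@[fun_prop]
lemma measurable_cross {Ω : Type*} [MeasurableSpace Ω] {X η : Ω → ℝ × ℝ}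
    (hX : Measurable X) (hη : Measurable η) : Measurable fun ω => cross (X ω) (η ω) := by
  unfold cross
  fun_prop

lemma measurableSet_almostParallel {Ω : Type*} [MeasurableSpace Ω] {τ t : Ω → ℝ}
    {X η : Ω → ℝ × ℝ} (hτ : Measurable τ) (hX : Measurable X) (ht : Measurable t)
    (hη : Measurable η) : MeasurableSet {ω | AlmostParallel (τ ω) (X ω) (t ω) (η ω)} := by
  unfold AlmostParallel
  rw [Set.ofPred_and]
  exact (measurableSet_le (by fun_prop) (by fun_prop)).inter
    (measurableSet_le (by fun_prop) (by fun_prop))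

lemma one_le_and_le_of_not_almostParallel {τ t M a ρ θ : ℝ} (hM : 0 ≤ M) (hρ : 0 < ρ)
    (hρM : 2 * M ≤ ρ)
    (h : ¬ AlmostParallel τ (M * cos a, M * sin a) t (ρ * cos θ, ρ * sin θ)) :
    1 ≤ M ∧ 8 * (1 + ρ) ^ 2 * (1 + |(|τ + t| - √(ρ ^ 2 + M ^ 2 + 2 * ρ * M * cos (θ - a)))|) ≤
      (1 + M) ^ 3 * sin (θ - a) ^ 2 := by
  unfold AlmostParallel at h
  rw [nrm_polar hM, nrm_polar hρ.le, cross_polar, nrm_add_polar] at h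
  push Not at h
  replace h := h hρM
  set L := |(|τ + t| - √(ρ ^ 2 + M ^ 2 + 2 * ρ * M * cos (θ - a)))|
  have hL : 0 ≤ L := abs_nonneg _
  have hMpos : 0 < M := by
    rcases hM.eq_or_lt with h0 | h0
    · rw [← h0] at h; simp at h
    · exact h0
  have h2 : 8 * (1 + ρ) ^ 2 * (1 + L) < (1 + M) ^ 3 * sin (θ - a) ^ 2 := by
    have hMρ : 0 < M ^ 2 * ρ ^ 2 := by positivity
    refine lt_of_mul_lt_mul_left ?_ hMρ.le
    calc _ = 8 * (1 + ρ) ^ 2 * (M ^ 2 * ρ ^ 2) * (1 + L) := by ring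
      _ < _ := h
      _ = _ := by ring
  refine ⟨?_, h2.le⟩
  by_contra! hM1
  have h3 : (1 + M) ^ 3 * sin (θ - a) ^ 2 ≤ 2 ^ 3 * 1 := by
    gcongr
    · linarith
    · exact sin_sq_le_one _
  have h4 : 8 * 1 * 1 ≤ 8 * (1 + ρ) ^ 2 * (1 + L) := by
    gcongr
    · nlinarith
    · linarith
  linarith

lemma waveKernel_le_of_two_mul_le {α β γ p τ t : ℝ} {X η : ℝ × ℝ} (hβ : 0 ≤ β)
    (h : 2 * nrm X ≤ nrm η) :
    waveKernel α β γ p τ X t η ≤ 2 ^ β * (decay α (nrm X) * decay (α + β) (nrm η)) *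
      decay p (|t| - nrm η) * decay γ (|τ + t| - nrm (X + η)) := by
  have htri := nrm_add_le (X + η) (-X)
  rw [nrm_neg, add_neg_cancel_comm] at htri
  have hη := nrm_nonneg η
  have h1 := decay_half_le hβ (nrm_nonneg (X + η)) (by linarith : nrm η ≤ 2 * nrm (X + η)) hη
  have e : decay (α + β) (nrm η) = decay α (nrm η) * decay β (nrm η) := by
    rw [decay_of_nonneg hη, decay_of_nonneg hη, decay_of_nonneg hη, ← rpow_add (by linarith)]
    congr 1; ring
  have hd := decay_nonneg
  have := hd α (nrm X)
  have := hd α (nrm η)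
  have := hd p (|t| - nrm η)
  have := hd γ (|τ + t| - nrm (X + η))
  rw [e, waveKernel]
  calc _ ≤ decay α (nrm X) * (decay α (nrm η) * decay p (|t| - nrm η)) *
        (2 ^ β * decay β (nrm η) * decay γ (|τ + t| - nrm (X + η))) := by gcongr
    _ = _ := by ring

lemma lintegral_angle_waveKernel_transversal_le {α β γ p : ℝ} (hγ : 1 / 2 < γ) (hβ : 0 ≤ β) :
    ∃ C : ℝ, 0 < C ∧ ∀ (τ t ρ : ℝ) (X : ℝ × ℝ), 0 < ρ → 2 * nrm X ≤ ρ →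
      ∫⁻ θ in Set.Ioo (-π) π, {η | 2 * nrm X ≤ nrm η ∧ ¬ AlmostParallel τ X t η}.indicator
          (fun η => ENNReal.ofReal (waveKernel α β γ p τ X t η)) (ρ * cos θ, ρ * sin θ) ≤
        ENNReal.ofReal
          (C * (decay α (nrm X) * √(nrm X) * decay (α + β) ρ) * decay p (|t| - ρ) / ρ) := by
  obtain ⟨C, hC, h⟩ := lintegral_angle_decay_transversal_le hγ
  refine ⟨2 ^ β * C, by positivity, fun τ t ρ X hρ hρM => ?_⟩
  obtain ⟨a, ha⟩ := exists_polar X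
  obtain ⟨M, hM⟩ : ∃ M, M = nrm X := ⟨_, rfl⟩
  have hM0 : 0 ≤ M := hM ▸ nrm_nonneg X
  rw [← hM] at ha hρM ⊢
  have hd := decay_nonneg
  set A : ℝ := 2 ^ β * (decay α M * decay (α + β) ρ) * decay p (|t| - ρ) with hA
  have hA0 : 0 ≤ A :=
    mul_nonneg (mul_nonneg (by positivity) (mul_nonneg (hd _ _) (hd _ _))) (hd _ _)
  by_cases hM1 : 1 ≤ M
  · set E : Set ℝ := {θ | 8 * (1 + ρ) ^ 2 * (1 + |(|τ + t| -
      √(ρ ^ 2 + M ^ 2 + 2 * ρ * M * cos (θ - a)))|) ≤ (1 + M) ^ 3 * sin (θ - a) ^ 2} with hE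
    have hEm : MeasurableSet E := measurableSet_le (by fun_prop) (by fun_prop)
    set S : Set (ℝ × ℝ) := {η | 2 * M ≤ nrm η ∧ ¬ AlmostParallel τ X t η} with hS
    have hle : ∀ θ, S.indicator
        (fun η => ENNReal.ofReal (waveKernel α β γ p τ X t η)) (ρ * cos θ, ρ * sin θ) ≤
        E.indicator (fun θ => ENNReal.ofReal A * ENNReal.ofReal (decay γ (|τ + t| -
          √(ρ ^ 2 + M ^ 2 + 2 * ρ * M * cos (θ - a))))) θ := by
      intro θ
      by_cases hη : (ρ * cos θ, ρ * sin θ) ∈ S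
      · have hθ : θ ∈ E := by
          refine (one_le_and_le_of_not_almostParallel hM0 hρ hρM ?_).2
          rw [← ha]; exact hη.2
        rw [Set.indicator_of_mem hη, Set.indicator_of_mem hθ, ← ENNReal.ofReal_mul hA0]
        refine ENNReal.ofReal_le_ofReal ((waveKernel_le_of_two_mul_le hβ (hM ▸ hη.1)).trans ?_)
        rw [← hM, nrm_polar hρ.le, ← nrm_add_polar, ← ha]
      · rw [Set.indicator_of_notMem hη]
        exact zero_le
    refine (lintegral_mono hle).trans ?_
    rw [lintegral_indicator hEm, Measure.restrict_restrict hEm, Set.inter_comm,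
      lintegral_const_mul _ (by fun_prop)]
    refine (mul_le_mul_right (h ρ M |τ + t| a hM1 hρM (abs_nonneg _)) _).trans ?_
    rw [← ENNReal.ofReal_mul hA0]
    refine ENNReal.ofReal_le_ofReal (le_of_eq ?_)
    rw [hA]; ring
  · refine le_trans (le_of_eq ?_) zero_le
    have : ∀ θ, {η | 2 * M ≤ nrm η ∧ ¬ AlmostParallel τ X t η}.indicator
        (fun η => ENNReal.ofReal (waveKernel α β γ p τ X t η)) (ρ * cos θ, ρ * sin θ) = 0 := by
      intro θ
      refine Set.indicator_of_notMem (fun hη => hM1 ?_) _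
      refine (one_le_and_le_of_not_almostParallel (τ := τ) (t := t) (a := a) (θ := θ)
        hM0 hρ hρM ?_).1
      rw [← ha]; exact hη.2
    simp [this]

/-- Contribution of `2 |X| ≤ |η|` away from the almost parallel region. -/
lemma lintegral_waveKernel_transversal_le {α β γ p : ℝ} (hp : 1 < p) (hγ : 1 / 2 < γ)
    (hβ : 0 ≤ β) (hαβ' : 1 < α + β) (hαβ : 3 / 2 ≤ 2 * α + β) :
    ∃ C : ℝ, 0 < C ∧ ∀ (τ : ℝ) (X : ℝ × ℝ),
      ∫⁻ t, ∫⁻ η in {η | 2 * nrm X ≤ nrm η ∧ ¬ AlmostParallel τ X t η},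
        ENNReal.ofReal (waveKernel α β γ p τ X t η) ≤ ENNReal.ofReal C := by
  obtain ⟨C₁, hC₁, h₁⟩ := lintegral_angle_waveKernel_transversal_le (α := α) (p := p) hγ hβ
  obtain ⟨C₂, hC₂, h₂⟩ := lintegral_decay_abs_sub_le hp
  have hαβ1 : 0 < α + β - 1 := by linarith
  refine ⟨C₁ * C₂ / (α + β - 1), by positivity, fun τ X => ?_⟩
  obtain ⟨M, hM⟩ : ∃ M, M = nrm X := ⟨_, rfl⟩
  have hM0 : 0 ≤ M := hM ▸ nrm_nonneg X
  have h₁' := fun t ρ => h₁ τ t ρ X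
  rw [← hM] at h₁' ⊢
  have hd := decay_nonneg
  have hmS : ∀ t, MeasurableSet {η | 2 * M ≤ nrm η ∧ ¬ AlmostParallel τ X t η} := fun t =>
    (measurableSet_le (g := nrm) (by fun_prop) (by fun_prop)).inter
      (measurableSet_almostParallel (by fun_prop) (by fun_prop) (by fun_prop)
        measurable_id).compl
  have hK0 : 0 ≤ C₁ * (decay α M * √M) := by
    have := hd α M
    positivity
  have hangle : ∀ t, ∫⁻ η in {η | 2 * M ≤ nrm η ∧ ¬ AlmostParallel τ X t η},
      ENNReal.ofReal (waveKernel α β γ p τ X t η) ≤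
      ∫⁻ ρ in Set.Ioi (0 : ℝ), ENNReal.ofReal (C₁ * (decay α M * √M)) *
        (Set.Ici (2 * M)).indicator (fun ρ => ENNReal.ofReal (decay (α + β) ρ)) ρ *
        ENNReal.ofReal (decay p (|t| - ρ)) := by
    intro t
    rw [← lintegral_indicator (hmS t)]
    have hmf : Measurable ({η | 2 * M ≤ nrm η ∧ ¬ AlmostParallel τ X t η}.indicator fun η =>
        ENNReal.ofReal (waveKernel α β γ p τ X t η)) :=
      Measurable.indicator (by fun_prop) (hmS t)
    refine (lintegral_le_of_polar (G := (Set.Ici (2 * M)).indicator fun ρ =>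
      ENNReal.ofReal (C₁ * (decay α M * √M * decay (α + β) ρ) * decay p (|t| - ρ) / ρ))
      hmf ?_).trans ?_
    · intro ρ hρ
      by_cases hρM : 2 * M ≤ ρ
      · rw [Set.indicator_of_mem (by exact hρM)]
        exact h₁' t ρ hρ hρM
      · refine le_trans (le_of_eq ?_) zero_le
        have : ∀ θ, {η | 2 * M ≤ nrm η ∧ ¬ AlmostParallel τ X t η}.indicator
            (fun η => ENNReal.ofReal (waveKernel α β γ p τ X t η))
              (ρ * cos θ, ρ * sin θ) = 0 := by
          intro θ
          refine Set.indicator_of_notMem (fun hη => hρM ?_) _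
          have := hη.1
          rwa [nrm_polar hρ.le] at this
        simp [this]
    · refine setLIntegral_mono' measurableSet_Ioi fun ρ hρ => ?_
      have hρ0 : (0 : ℝ) < ρ := hρ
      by_cases hρM : 2 * M ≤ ρ
      · rw [Set.indicator_of_mem (by exact hρM), Set.indicator_of_mem (by exact hρM),
          ← ENNReal.ofReal_mul hρ0.le, ← ENNReal.ofReal_mul hK0,
          ← ENNReal.ofReal_mul (mul_nonneg hK0 (hd _ _))]
        refine ENNReal.ofReal_le_ofReal (le_of_eq ?_)
        field_simp
      · rw [Set.indicator_of_notMem (by exact hρM)]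
        simp
  calc _ ≤ ∫⁻ t, ∫⁻ ρ in Set.Ioi (0 : ℝ), ENNReal.ofReal (C₁ * (decay α M * √M)) *
        (Set.Ici (2 * M)).indicator (fun ρ => ENNReal.ofReal (decay (α + β) ρ)) ρ *
        ENNReal.ofReal (decay p (|t| - ρ)) := lintegral_mono hangle
    _ = ∫⁻ ρ in Set.Ioi (0 : ℝ), ENNReal.ofReal (C₁ * (decay α M * √M)) *
        (Set.Ici (2 * M)).indicator (fun ρ => ENNReal.ofReal (decay (α + β) ρ)) ρ *
        ∫⁻ t, ENNReal.ofReal (decay p (|t| - ρ)) := by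
      have hmi : Measurable ((Set.Ici (2 * M)).indicator
          fun ρ => ENNReal.ofReal (decay (α + β) ρ)) :=
        Measurable.indicator (by fun_prop) measurableSet_Ici
      rw [lintegral_lintegral_swap (by fun_prop)]
      congr 1; ext ρ
      rw [lintegral_const_mul _ (by fun_prop)]
    _ ≤ ∫⁻ ρ in Set.Ioi (0 : ℝ), ENNReal.ofReal (C₁ * (decay α M * √M)) * ENNReal.ofReal C₂ *
        (Set.Ici (2 * M)).indicator (fun ρ => ENNReal.ofReal (decay (α + β) ρ)) ρ := by
      refine lintegral_mono fun ρ => ?_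
      rw [mul_right_comm]
      gcongr
      simpa using h₂ ρ 0
    _ ≤ ENNReal.ofReal (C₁ * (decay α M * √M)) * ENNReal.ofReal C₂ *
        ∫⁻ ρ in Set.Ioi (2 * M), ENNReal.ofReal ((1 + ρ) ^ (-(α + β))) := by
      rw [lintegral_const_mul' _ _ (by finiteness)]
      refine mul_le_mul_right ?_ _
      refine (setLIntegral_le_lintegral _ _).trans ?_
      rw [lintegral_indicator measurableSet_Ici, setLIntegral_congr Ioi_ae_eq_Ici.symm]
      refine setLIntegral_mono' measurableSet_Ioi fun ρ hρ => ?_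
      rw [decay_of_nonneg (by linarith [Set.mem_Ioi.1 hρ])]
    _ ≤ ENNReal.ofReal (C₁ * (decay α M * √M)) * ENNReal.ofReal C₂ *
        ENNReal.ofReal ((1 + 2 * M) ^ (-(α + β) + 1) / (-(-(α + β) + 1))) := by
      gcongr
      exact lintegral_Ioi_one_add_rpow_le (by linarith) (by linarith)
    _ ≤ _ := by
      rw [← ENNReal.ofReal_mul hK0, ← ENNReal.ofReal_mul (by positivity)]
      refine ENNReal.ofReal_le_ofReal ?_
      have hM1 : 0 < 1 + M := by linarith
      have e1 : (1 + 2 * M) ^ (-(α + β) + 1) ≤ (1 + M) ^ (-(α + β) + 1) :=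
        rpow_le_rpow_of_nonpos hM1 (by linarith) (by linarith)
      have e2 : √M ≤ (1 + M) ^ (1 / 2 : ℝ) := by
        rw [← sqrt_eq_rpow]
        exact sqrt_le_sqrt (by linarith)
      have e3 : (1 + M) ^ (-α) * (1 + M) ^ (1 / 2 : ℝ) * (1 + M) ^ (-(α + β) + 1) ≤ 1 := by
        rw [← rpow_add hM1, ← rpow_add hM1]
        exact rpow_le_one_of_one_le_of_nonpos (by linarith) (by linarith)
      rw [show -(-(α + β) + 1) = α + β - 1 by ring, decay_of_nonneg hM0]
      calc _ ≤ C₁ * ((1 + M) ^ (-α) * (1 + M) ^ (1 / 2 : ℝ)) * C₂ *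
            ((1 + M) ^ (-(α + β) + 1) / (α + β - 1)) := by gcongr
        _ = C₁ * C₂ / (α + β - 1) *
            ((1 + M) ^ (-α) * (1 + M) ^ (1 / 2 : ℝ) * (1 + M) ^ (-(α + β) + 1)) := by ring
        _ ≤ C₁ * C₂ / (α + β - 1) * 1 := by gcongr
        _ = _ := mul_one _

lemma waveKernel_le_of_two_mul_le' {α β γ p τ t : ℝ} {X η : ℝ × ℝ} (hα : 0 ≤ α)
    (h : 2 * nrm X ≤ nrm η) :
    waveKernel α β γ p τ X t η ≤ 2 ^ α * (decay α (nrm X) * decay α (nrm (X + η))) *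
      decay β (nrm (X + η)) * decay γ (|τ + t| - nrm (X + η)) * decay p (|t| - nrm η) := by
  have hη := nrm_nonneg η
  have hX := nrm_nonneg X
  have htri := nrm_add_le X η
  have h1 := decay_half_le hα hη (by linarith : nrm (X + η) ≤ 2 * nrm η) (nrm_nonneg _)
  have hd := decay_nonneg
  have := hd α (nrm X)
  have := hd β (nrm (X + η))
  have := hd p (|t| - nrm η)
  have := hd γ (|τ + t| - nrm (X + η))
  rw [waveKernel]
  calc _ ≤ decay α (nrm X) * (2 ^ α * decay α (nrm (X + η)) * decay p (|t| - nrm η)) *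
        (decay β (nrm (X + η)) * decay γ (|τ + t| - nrm (X + η))) := by gcongr
    _ = _ := by ring

/-- The almost parallel condition in terms of the output frequency `Y = X + η`. -/
lemma AlmostParallel.le_and_sin_sq_le {τ t M a R b : ℝ} {η : ℝ × ℝ} (hM : 0 < M) (hR : 0 ≤ R)
    (hη : (M * cos b, M * sin b) + η = (R * cos a, R * sin a))
    (h : AlmostParallel τ (M * cos b, M * sin b) t η) :
    M ≤ R ∧ sin (b - a) ^ 2 ≤
      (12 * (1 + R) * √(1 + |(|τ + t| - R)|) * (1 + M) ^ (-(3 / 2) : ℝ)) ^ 2 := by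
  obtain ⟨h1, h2⟩ := h
  rw [nrm_polar hM.le] at h1 h2
  have htri := nrm_add_le ((M * cos b, M * sin b) + η) (-(M * cos b, M * sin b))
  rw [nrm_neg, add_neg_cancel_comm, hη, nrm_polar hR, nrm_polar hM.le] at htri
  have hMR : M ≤ R := by linarith
  have hRpos : 0 < R := by linarith
  have hη2 : nrm η ≤ 2 * R := by linarith
  have hηn := nrm_nonneg η
  refine ⟨hMR, ?_⟩
  rw [hη, nrm_polar hR] at h2
  set L := 1 + |(|τ + t| - R)| with hL
  have hLpos : 0 < L := by positivity
  have hc : cross (M * cos b, M * sin b) η ^ 2 = M ^ 2 * R ^ 2 * sin (b - a) ^ 2 := by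
    have e : η = (R * cos a, R * sin a) - (M * cos b, M * sin b) := by rw [← hη]; abel
    rw [e, sin_sub]
    simp only [cross, Prod.fst_sub, Prod.snd_sub]
    ring
  rw [hc] at h2
  have hM1 : 0 < 1 + M := by linarith
  have e3 : ((1 + M) ^ (-(3 / 2) : ℝ)) ^ 2 = ((1 + M) ^ 3)⁻¹ := by
    rw [← rpow_natCast, ← rpow_mul hM1.le, ← rpow_natCast, ← rpow_neg hM1.le]
    norm_num
  rw [mul_pow, mul_pow, mul_pow, sq_sqrt hLpos.le, e3, ← div_eq_mul_inv,
    le_div_iff₀ (by positivity)]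
  have hMR2 : 0 < M ^ 2 * R ^ 2 := by positivity
  refine le_of_mul_le_mul_left ?_ hMR2
  calc _ = (1 + M) ^ 3 * (M ^ 2 * R ^ 2 * sin (b - a) ^ 2) := by ring
    _ ≤ 8 * (1 + nrm η) ^ 2 * (M ^ 2 * nrm η ^ 2) * L := h2
    _ ≤ 8 * (2 * (1 + R)) ^ 2 * (M ^ 2 * (2 * R) ^ 2) * L := by gcongr; linarith
    _ = M ^ 2 * R ^ 2 * (128 * (1 + R) ^ 2 * L) := by ring
    _ ≤ M ^ 2 * R ^ 2 * (12 ^ 2 * (1 + R) ^ 2 * L) := by gcongr; norm_num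

/-- Contribution of the almost parallel region, for a fixed output frequency `(T, Y)`. -/
lemma lintegral_waveKernel_parallel_le {α β γ p : ℝ} (hp : 1 < p) (hγ : 1 / 2 ≤ γ)
    (hα : 0 ≤ α) (hα' : α < 1 / 2) (hαβ : 3 / 2 ≤ 2 * α + β) :
    ∃ C : ℝ, 0 < C ∧ ∀ (T : ℝ) (Y : ℝ × ℝ),
      ∫⁻ X, ∫⁻ τ, {τ | AlmostParallel τ X (T - τ) (Y - X)}.indicator
        (fun τ => ENNReal.ofReal (waveKernel α β γ p τ X (T - τ) (Y - X))) τ ≤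
      ENNReal.ofReal C := by
  obtain ⟨C₁, hC₁, h₁⟩ := volume_angle_parallel_le
  obtain ⟨C₂, hC₂, h₂⟩ := lintegral_decay_abs_sub_le hp
  have hα1 : 0 < 1 / 2 - α := by linarith
  refine ⟨2 ^ α * C₂ * C₁ * 12 / (1 / 2 - α), by positivity, fun T Y => ?_⟩
  obtain ⟨a, ha⟩ := exists_polar Y
  obtain ⟨R, hR⟩ : ∃ R, R = nrm Y := ⟨_, rfl⟩
  have hR0 : 0 ≤ R := hR ▸ nrm_nonneg Y
  rw [← hR] at ha
  have hd := decay_nonneg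
  obtain ⟨L, hL⟩ : ∃ L, L = 1 + |(|T| - R)| := ⟨_, rfl⟩
  have hL1 : 1 ≤ L := by rw [hL]; linarith [abs_nonneg (|T| - R)]
  set A : ℝ := 2 ^ α * C₂ * decay α R * decay β R * decay γ (|T| - R) with hA
  have hA0 : 0 ≤ A :=
      mul_nonneg (mul_nonneg (mul_nonneg (by positivity) (hd _ _)) (hd _ _)) (hd _ _)
  set κ : ℝ → ℝ := fun M => 12 * (1 + R) * √L * (1 + M) ^ (-(3 / 2) : ℝ) with hκ
  have hκpos : ∀ M, 0 < M → 0 < κ M := fun M hM => by positivity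
  have hPeq : ∀ X τ, AlmostParallel τ X (T - τ) (Y - X) ↔ AlmostParallel 0 X T (Y - X) := by
    intro X τ
    simp only [AlmostParallel, add_sub_cancel, zero_add]
  have htime : ∀ X, ∫⁻ τ, {τ | AlmostParallel τ X (T - τ) (Y - X)}.indicator
      (fun τ => ENNReal.ofReal (waveKernel α β γ p τ X (T - τ) (Y - X))) τ ≤
      {X | AlmostParallel 0 X T (Y - X)}.indicator
        (fun X => ENNReal.ofReal (A * decay α (nrm X))) X := by
    intro X
    simp only [hPeq]
    by_cases hX : AlmostParallel 0 X T (Y - X)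
    · rw [Set.indicator_of_mem (s := {X | AlmostParallel 0 X T (Y - X)}) hX]
      refine (lintegral_mono (Set.indicator_le_self _ _)).trans ?_
      refine (lintegral_mono fun τ => ENNReal.ofReal_le_ofReal
        (waveKernel_le_of_two_mul_le' hα hX.1)).trans ?_
      simp only [add_sub_cancel, ← hR]
      have hB : 0 ≤ 2 ^ α * (decay α (nrm X) * decay α R) * decay β R * decay γ (|T| - R) :=
        mul_nonneg (mul_nonneg (mul_nonneg (by positivity) (mul_nonneg (hd _ _) (hd _ _)))
          (hd _ _)) (hd _ _)
      simp_rw [ENNReal.ofReal_mul hB]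
      rw [lintegral_const_mul' _ _ ENNReal.ofReal_ne_top]
      have := h₂ (nrm (Y - X)) (-T)
      simp_rw [← sub_eq_neg_add, abs_sub_comm _ T] at this
      refine (mul_le_mul_right this _).trans ?_
      rw [← ENNReal.ofReal_mul hB]
      exact ENNReal.ofReal_le_ofReal (le_of_eq (by rw [hA]; ring))
    · rw [Set.indicator_of_notMem (s := {X | AlmostParallel 0 X T (Y - X)}) hX]
      simp [hX]
  refine (lintegral_mono htime).trans ?_
  have hmP : MeasurableSet {X | AlmostParallel 0 X T (Y - X)} :=
    measurableSet_almostParallel (by fun_prop) measurable_id (by fun_prop) (by fun_prop)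
  refine (lintegral_le_of_polar (G := (Set.Iic R).indicator fun M =>
    ENNReal.ofReal (A * decay α M) * ENNReal.ofReal (C₁ * κ M))
    (Measurable.indicator (by fun_prop) hmP) ?_).trans ?_
  · intro M hM
    have hmem : ∀ b, (M * cos b, M * sin b) ∈ {X | AlmostParallel 0 X T (Y - X)} →
        M ≤ R ∧ sin (b - a) ^ 2 ≤ κ M ^ 2 := by
      intro b hb
      have := AlmostParallel.le_and_sin_sq_le (a := a) hM hR0 (by rw [← ha]; abel) hb
      rwa [zero_add, ← hL] at this
    by_cases hMR : M ≤ R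
    · rw [Set.indicator_of_mem (by exact hMR)]
      have hmE : MeasurableSet {b | sin (b - a) ^ 2 ≤ κ M ^ 2} :=
        measurableSet_le (by fun_prop) (by fun_prop)
      calc _ ≤ ∫⁻ b in Set.Ioo (-π) π, {b | sin (b - a) ^ 2 ≤ κ M ^ 2}.indicator
            (fun _ => ENNReal.ofReal (A * decay α M)) b := by
            refine lintegral_mono fun b => ?_
            by_cases hb : (M * cos b, M * sin b) ∈ {X | AlmostParallel 0 X T (Y - X)}
            · rw [Set.indicator_of_mem hb, Set.indicator_of_mem (by exact (hmem b hb).2),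
                nrm_polar hM.le]
            · rw [Set.indicator_of_notMem hb]
              exact zero_le
        _ = ENNReal.ofReal (A * decay α M) *
            volume (Set.Ioo (-π) π ∩ {b | sin (b - a) ^ 2 ≤ κ M ^ 2}) := by
            rw [lintegral_indicator_const hmE, Measure.restrict_apply hmE, Set.inter_comm]
        _ ≤ _ := by
            gcongr
            exact h₁ (κ M) a (hκpos M hM)
    · refine le_trans (le_of_eq ?_) zero_le
      have : ∀ b, {X | AlmostParallel 0 X T (Y - X)}.indicator
          (fun X => ENNReal.ofReal (A * decay α (nrm X))) (M * cos b, M * sin b) = 0 :=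
        fun b => Set.indicator_of_notMem (fun hb => hMR (hmem b hb).1) _
      simp [this]
  · calc _ = ∫⁻ M in Set.Ioi (0 : ℝ), (Set.Iic R).indicator (fun M => ENNReal.ofReal M *
          (ENNReal.ofReal (A * decay α M) * ENNReal.ofReal (C₁ * κ M))) M := by
          congr 1; ext M
          by_cases hM : M ∈ Set.Iic R <;> simp [hM]
      _ = ∫⁻ M in Set.Ioc 0 R, ENNReal.ofReal M *
          (ENNReal.ofReal (A * decay α M) * ENNReal.ofReal (C₁ * κ M)) := by
          rw [lintegral_indicator measurableSet_Iic, Measure.restrict_restrict measurableSet_Iic,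
            Set.Iic_inter_Ioi]
      _ ≤ ∫⁻ M in Set.Ioc 0 R, ENNReal.ofReal (A * C₁ * 12 * (1 + R) * √L) *
          ENNReal.ofReal ((1 + M) ^ (-(1 / 2) - α)) := by
          refine setLIntegral_mono' measurableSet_Ioc fun M hM => ?_
          have hM1 : 0 < 1 + M := by linarith [hM.1]
          rw [← ENNReal.ofReal_mul (mul_nonneg hA0 (hd _ _)), ← ENNReal.ofReal_mul hM.1.le,
            ← ENNReal.ofReal_mul (by positivity)]
          refine ENNReal.ofReal_le_ofReal ?_
          have e : (1 + M) ^ (-(1 / 2) - α) =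
              (1 + M) * (decay α M * (1 + M) ^ (-(3 / 2) : ℝ)) := by
            rw [decay_of_nonneg hM.1.le, ← rpow_add hM1]
            nth_rw 2 [← rpow_one (1 + M)]
            rw [← rpow_add hM1]
            congr 1; ring
          have := hd α M
          rw [e, hκ]
          calc _ = A * C₁ * 12 * (1 + R) * √L *
                (M * (decay α M * (1 + M) ^ (-(3 / 2) : ℝ))) := by ring
            _ ≤ _ := by gcongr; linarith
      _ ≤ ENNReal.ofReal (A * C₁ * 12 * (1 + R) * √L) *
          ENNReal.ofReal ((1 + R) ^ (-(1 / 2) - α + 1) / (-(1 / 2) - α + 1)) := by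
          rw [lintegral_const_mul' _ _ ENNReal.ofReal_ne_top]
          gcongr
          exact lintegral_Ioc_one_add_rpow_le (by linarith) hR0
      _ ≤ _ := by
          rw [← ENNReal.ofReal_mul (by positivity)]
          refine ENNReal.ofReal_le_ofReal ?_
          have hR1 : 0 < 1 + R := by linarith
          have e1 : decay γ (|T| - R) * √L ≤ 1 := by
            rw [decay, ← hL, sqrt_eq_rpow, ← rpow_add (by linarith)]
            exact rpow_le_one_of_one_le_of_nonpos hL1 (by linarith)
          have e2 : decay α R * decay β R * (1 + R) * (1 + R) ^ (-(1 / 2) - α + 1) ≤ 1 := by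
            rw [decay_of_nonneg hR0, decay_of_nonneg hR0, ← rpow_add hR1]
            nth_rw 2 [← rpow_one (1 + R)]
            rw [← rpow_add hR1, ← rpow_add hR1]
            exact rpow_le_one_of_one_le_of_nonpos (by linarith) (by linarith)
          have := hd γ (|T| - R)
          rw [show -(1 / 2) - α + 1 = 1 / 2 - α by ring] at e2 ⊢
          calc _ = 2 ^ α * C₂ * C₁ * 12 / (1 / 2 - α) * (decay γ (|T| - R) * √L) *
                (decay α R * decay β R * (1 + R) * (1 + R) ^ (1 / 2 - α)) := by rw [hA]; ring
            _ ≤ 2 ^ α * C₂ * C₁ * 12 / (1 / 2 - α) * 1 * 1 := by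
                have := mul_nonneg (mul_nonneg (mul_nonneg (hd α R) (hd β R)) hR1.le)
                  (rpow_nonneg hR1.le (1 / 2 - α))
                gcongr
            _ = _ := by ring

/-- The spatial part of a space-time point. -/
def spatial (ζ : SpaceTime) : ℝ × ℝ := (ζ 1, ζ 2)

@[fun_prop]
lemma measurable_spatial : Measurable spatial := by unfold spatial; fun_prop

lemma spFreq_eq_nrm (ζ : SpaceTime) : spFreq ζ = nrm (spatial ζ) := rfl

lemma spatial_add (ζ ω : SpaceTime) : spatial (ζ + ω) = spatial ζ + spatial ω := rfl

lemma lintegral_spaceTime {F : ℝ → ℝ × ℝ → ENNReal} (hF : Measurable (Function.uncurry F)) :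
    ∫⁻ ζ : SpaceTime, F (ζ 0) (spatial ζ) = ∫⁻ t, ∫⁻ η, F t η := by
  have h1 := (PiLp.volume_preserving_toLp (Fin 3)).lintegral_comp
    (f := fun ζ : SpaceTime => F (ζ 0) (spatial ζ)) (by fun_prop)
  rw [← h1]
  have h2 := (volume_preserving_piFinSuccAbove (fun _ : Fin 3 => ℝ) 0).lintegral_comp
    (f := fun q : ℝ × (Fin 2 → ℝ) => F q.1 (q.2 0, q.2 1)) (by fun_prop)
  have h3 : ∀ t, ∫⁻ η : Fin 2 → ℝ, F t (η 0, η 1) = ∫⁻ η, F t η := fun t =>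
    (volume_preserving_finTwoArrow ℝ).lintegral_comp (f := F t) (by fun_prop)
  simp_rw [← h3]
  rw [Measure.volume_eq_prod, lintegral_prod _ (by fun_prop)] at h2
  exact h2

/-- The bounds for the kernel that enter the Schur test. -/
lemma exists_lintegral_waveKernel_le {α β γ p : ℝ} (hp : 1 < p) (hγ : 1 / 2 < γ) (hγp : γ ≤ p)
    (hα : 0 ≤ α) (hα' : α < 1 / 2) (hβ : 0 ≤ β) (hβ' : β < 3 / 2) (hαβ' : 1 < α + β)
    (hαβ : 3 / 2 ≤ 2 * α + β) :
    ∃ C : ℝ, 0 < C ∧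
      (∀ y : SpaceTime, ∫⁻ z : SpaceTime,
        {z : SpaceTime | AlmostParallel (z 0) (spatial z) ((y - z) 0)
          (spatial (y - z))}.indicator (fun z => ENNReal.ofReal
          (waveKernel α β γ p (z 0) (spatial z) ((y - z) 0) (spatial (y - z)))) z ≤
            ENNReal.ofReal C) ∧
      ∀ z : SpaceTime, ∫⁻ w : SpaceTime,
        {w : SpaceTime | ¬ AlmostParallel (z 0) (spatial z) (w 0) (spatial w)}.indicator
          (fun w => ENNReal.ofReal
            (waveKernel α β γ p (z 0) (spatial z) (w 0) (spatial w))) w ≤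
          ENNReal.ofReal C := by
  obtain ⟨C₁, hC₁, h₁⟩ := lintegral_waveKernel_disc_le hp hγ hγp hα (by linarith) hβ hβ' hαβ
  obtain ⟨C₂, hC₂, h₂⟩ := lintegral_waveKernel_transversal_le hp hγ hβ hαβ' hαβ
  obtain ⟨C₃, hC₃, h₃⟩ := lintegral_waveKernel_parallel_le hp hγ.le hα hα' hαβ
  refine ⟨C₁ + C₂ + C₃, by positivity, fun y => ?_, fun z => ?_⟩
  · have hm : Measurable (Function.uncurry fun (t : ℝ) (X : ℝ × ℝ) =>
        {t | AlmostParallel t X (y 0 - t) (spatial y - X)}.indicator (fun t => ENNReal.ofReal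
          (waveKernel α β γ p t X (y 0 - t) (spatial y - X))) t) := by
      refine Measurable.indicator (s := {q : ℝ × (ℝ × ℝ) |
        AlmostParallel q.1 q.2 (y 0 - q.1) (spatial y - q.2)}) (f := fun q => ENNReal.ofReal
          (waveKernel α β γ p q.1 q.2 (y 0 - q.1) (spatial y - q.2))) (by fun_prop) ?_
      exact measurableSet_almostParallel (by fun_prop) (by fun_prop) (by fun_prop) (by fun_prop)
    have := lintegral_spaceTime hm
    rw [lintegral_lintegral_swap hm.aemeasurable] at this
    refine (this.le.trans (h₃ (y 0) (spatial y))).trans (ENNReal.ofReal_le_ofReal ?_)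
    linarith
  · set τ := z 0
    set X := spatial z
    have hm : Measurable (Function.uncurry fun (t : ℝ) (η : ℝ × ℝ) =>
        {η | ¬ AlmostParallel τ X t η}.indicator (fun η => ENNReal.ofReal
          (waveKernel α β γ p τ X t η)) η) := by
      refine Measurable.indicator (s := {q : ℝ × (ℝ × ℝ) | ¬ AlmostParallel τ X q.1 q.2})
        (f := fun q => ENNReal.ofReal (waveKernel α β γ p τ X q.1 q.2)) (by fun_prop) ?_
      exact (measurableSet_almostParallel (by fun_prop) (by fun_prop) (by fun_prop)
        (by fun_prop)).compl
    refine (lintegral_spaceTime hm).le.trans ?_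
    have hmd : MeasurableSet {η | nrm η ≤ 2 * nrm X} :=
      measurableSet_le (by fun_prop) (by fun_prop)
    have hmt : ∀ t, MeasurableSet {η | 2 * nrm X ≤ nrm η ∧ ¬ AlmostParallel τ X t η} := by
      intro t
      rw [Set.ofPred_and]
      exact (measurableSet_le (by fun_prop) (by fun_prop)).inter
        (measurableSet_almostParallel (by fun_prop) (by fun_prop) (by fun_prop)
          measurable_id).compl
    calc _ ≤ ∫⁻ t, ((∫⁻ η in {η | nrm η ≤ 2 * nrm X},
            ENNReal.ofReal (waveKernel α β γ p τ X t η)) +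
          ∫⁻ η in {η | 2 * nrm X ≤ nrm η ∧ ¬ AlmostParallel τ X t η},
            ENNReal.ofReal (waveKernel α β γ p τ X t η)) := by
          refine lintegral_mono fun t => ?_
          rw [← lintegral_indicator hmd, ← lintegral_indicator (hmt t),
            ← lintegral_add_left (Measurable.indicator (by fun_prop) hmd)]
          refine lintegral_mono fun η => ?_
          by_cases hP : AlmostParallel τ X t η
          · simp [hP]
          · rcases le_total (nrm η) (2 * nrm X) with h | h
            · simp [hP, h]
            · simp [hP, h]
      _ = (∫⁻ t, ∫⁻ η in {η | nrm η ≤ 2 * nrm X},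
            ENNReal.ofReal (waveKernel α β γ p τ X t η)) +
          ∫⁻ t, ∫⁻ η in {η | 2 * nrm X ≤ nrm η ∧ ¬ AlmostParallel τ X t η},
            ENNReal.ofReal (waveKernel α β γ p τ X t η) := by
          refine lintegral_add_left ?_ _
          exact Measurable.lintegral_prod_right' (f := fun q : ℝ × (ℝ × ℝ) =>
            ENNReal.ofReal (waveKernel α β γ p τ X q.1 q.2)) (by fun_prop)
      _ ≤ ENNReal.ofReal C₁ + ENNReal.ofReal C₂ := by
          refine add_le_add ?_ (h₂ τ X)
          rw [lintegral_lintegral_swap (by fun_prop)]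
          exact h₁ τ X
      _ ≤ _ := by
          rw [← ENNReal.ofReal_add hC₁.le hC₂.le]
          exact ENNReal.ofReal_le_ofReal (by linarith)

section Schur

lemma ENNReal.add_sq_le_two_mul (a b : ENNReal) : (a + b) ^ 2 ≤ 2 * (a ^ 2 + b ^ 2) := by
  have := ENNReal.rpow_add_le_mul_rpow_add_rpow a b (p := 2) (by norm_num)
  norm_num at this
  exact this

/-- Weighted Cauchy–Schwarz inequality. -/
lemma sq_lintegral_mul_le {G : Type*} [MeasurableSpace G] (μ : Measure G)
    {F I k : G → ENNReal} (hF : Measurable F) (hI : Measurable I) (hk : Measurable k)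
    (hk0 : ∀ x, k x ≠ 0) (hkt : ∀ x, k x ≠ ⊤) :
    (∫⁻ x, F x * I x ∂μ) ^ 2 ≤ (∫⁻ x, F x ^ 2 / k x ∂μ) * ∫⁻ x, k x * I x ^ 2 ∂μ := by
  have h := ENNReal.lintegral_mul_le_Lp_mul_Lq μ Real.HolderConjugate.two_two
    (f := fun x => F x * (k x) ^ (-(1 / 2) : ℝ)) (g := fun x => (k x) ^ (1 / 2 : ℝ) * I x)
    (by fun_prop) (by fun_prop)
  have e1 : ∀ x, ((fun x => F x * (k x) ^ (-(1 / 2) : ℝ)) *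
      fun x => (k x) ^ (1 / 2 : ℝ) * I x) x = F x * I x := by
    intro x
    rw [Pi.mul_apply, mul_assoc, ← mul_assoc (k x ^ _), ← ENNReal.rpow_add _ _ (hk0 x) (hkt x)]
    norm_num
  have e2 : ∀ x, (F x * (k x) ^ (-(1 / 2) : ℝ)) ^ (2 : ℝ) = F x ^ 2 / k x := by
    intro x
    rw [ENNReal.mul_rpow_of_nonneg _ _ (by norm_num), ← ENNReal.rpow_mul, div_eq_mul_inv]
    norm_num [ENNReal.rpow_neg_one, div_eq_mul_inv]
  have e3 : ∀ x, ((k x) ^ (1 / 2 : ℝ) * I x) ^ (2 : ℝ) = k x * I x ^ 2 := by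
    intro x
    rw [ENNReal.mul_rpow_of_nonneg _ _ (by norm_num), ← ENNReal.rpow_mul]
    norm_num
  simp_rw [e1, e2, e3] at h
  calc _ ≤ ((∫⁻ x, F x ^ 2 / k x ∂μ) ^ (1 / 2 : ℝ) *
        (∫⁻ x, k x * I x ^ 2 ∂μ) ^ (1 / 2 : ℝ)) ^ 2 := by gcongr
    _ = _ := by
      rw [mul_pow, ← ENNReal.rpow_natCast, ← ENNReal.rpow_mul, ← ENNReal.rpow_natCast,
        ← ENNReal.rpow_mul]
      norm_num

lemma sq_lintegral_indicator_le {G : Type*} [MeasurableSpace G] (μ : Measure G)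
    {F k : G → ENNReal} (hF : Measurable F) (hk : Measurable k) (hk0 : ∀ x, k x ≠ 0)
    (hkt : ∀ x, k x ≠ ⊤) {S : Set G} (hS : MeasurableSet S) :
    (∫⁻ x, S.indicator F x ∂μ) ^ 2 ≤ (∫⁻ x, F x ^ 2 / k x ∂μ) * ∫⁻ x, S.indicator k x ∂μ := by
  have h := sq_lintegral_mul_le μ hF (I := S.indicator 1) (measurable_one.indicator hS) hk hk0 hkt
  have e1 : ∀ x, F x * S.indicator 1 x = S.indicator F x := fun x => by
    by_cases hx : x ∈ S <;> simp [hx]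
  have e2 : ∀ x, k x * S.indicator 1 x ^ 2 = S.indicator k x := fun x => by
    by_cases hx : x ∈ S <;> simp [hx]
  simpa only [e1, e2] using h

variable {G : Type*} [AddCommGroup G] [MeasurableSpace G] [MeasurableAdd₂ G] [MeasurableNeg G]
  {μ : Measure G} [SFinite μ] [μ.IsAddLeftInvariant]

lemma lintegral_lintegral_mul_sub {a b : G → ENNReal} (ha : Measurable a) (hb : Measurable b) :
    ∫⁻ y, ∫⁻ z, a z * b (y - z) ∂μ ∂μ = (∫⁻ z, a z ∂μ) * ∫⁻ w, b w ∂μ := by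
  rw [lintegral_lintegral_swap (by fun_prop)]
  simp_rw [fun z => lintegral_const_mul (μ := μ) (a z)
      (by fun_prop : Measurable fun y => b (y - z)),
    fun z => lintegral_sub_right_eq_self (μ := μ) b z]
  rw [lintegral_mul_const _ ha]

/-- Schur test with the output frequency frozen. -/
lemma lintegral_mul_sq_conv_le_of_output {k₁ k₂ k₀ : G → ENNReal} (h₁ : Measurable k₁)
    (h₂ : Measurable k₂) (h₁0 : ∀ x, k₁ x ≠ 0) (h₁t : ∀ x, k₁ x ≠ ⊤)
    (h₂0 : ∀ x, k₂ x ≠ 0) (h₂t : ∀ x, k₂ x ≠ ⊤) {S : Set (G × G)} (hS : MeasurableSet S)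
    {C : ENNReal}
    (hC : ∀ y, ∫⁻ z, {z | (z, y - z) ∈ S}.indicator
      (fun z => k₁ z * k₂ (y - z) * k₀ y) z ∂μ ≤ C) (hk0 : ∀ x, k₀ x ≠ ⊤)
    {f g : G → ENNReal} (hf : Measurable f) (hg : Measurable g) :
    ∫⁻ y, k₀ y * (∫⁻ z, {z | (z, y - z) ∈ S}.indicator (fun z => f z * g (y - z)) z ∂μ) ^ 2 ∂μ ≤
      C * ((∫⁻ z, f z ^ 2 / k₁ z ∂μ) * ∫⁻ w, g w ^ 2 / k₂ w ∂μ) := by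
  have hpt : ∀ y, k₀ y *
      (∫⁻ z, {z | (z, y - z) ∈ S}.indicator (fun z => f z * g (y - z)) z ∂μ) ^ 2 ≤
      C * ∫⁻ z, f z ^ 2 / k₁ z * (g (y - z) ^ 2 / k₂ (y - z)) ∂μ := by
    intro y
    have hSy : MeasurableSet {z | (z, y - z) ∈ S} :=
      (by fun_prop : Measurable fun z : G => (z, y - z)) hS
    have h := sq_lintegral_indicator_le μ (F := fun z => f z * g (y - z))
      (k := fun z => k₁ z * k₂ (y - z)) (by fun_prop) (by fun_prop)
      (fun z => mul_ne_zero (h₁0 z) (h₂0 _)) (fun z => ENNReal.mul_ne_top (h₁t z) (h₂t _)) hSy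
    have e1 : ∀ z, (f z * g (y - z)) ^ 2 / (k₁ z * k₂ (y - z)) =
        f z ^ 2 / k₁ z * (g (y - z) ^ 2 / k₂ (y - z)) := by
      intro z
      rw [mul_pow, ENNReal.mul_div_mul_comm (Or.inr (h₂t _)) (Or.inl (h₁t _))]
    simp_rw [e1] at h
    have h' := hC y
    have e2 : ∀ z, {z | (z, y - z) ∈ S}.indicator (fun z => k₁ z * k₂ (y - z) * k₀ y) z =
        k₀ y * {z | (z, y - z) ∈ S}.indicator (fun z => k₁ z * k₂ (y - z)) z := by
      intro z
      by_cases hz : z ∈ {z | (z, y - z) ∈ S}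
      · rw [Set.indicator_of_mem hz, Set.indicator_of_mem hz, mul_comm]
      · rw [Set.indicator_of_notMem hz, Set.indicator_of_notMem hz, mul_zero]
    simp_rw [e2] at h'
    rw [lintegral_const_mul' _ _ (hk0 y)] at h'
    calc _ ≤ k₀ y * ((∫⁻ z, f z ^ 2 / k₁ z * (g (y - z) ^ 2 / k₂ (y - z)) ∂μ) *
          ∫⁻ z, {z | (z, y - z) ∈ S}.indicator (fun z => k₁ z * k₂ (y - z)) z ∂μ) := by gcongr
      _ = (k₀ y * ∫⁻ z, {z | (z, y - z) ∈ S}.indicator (fun z => k₁ z * k₂ (y - z)) z ∂μ) *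
          ∫⁻ z, f z ^ 2 / k₁ z * (g (y - z) ^ 2 / k₂ (y - z)) ∂μ := by ring
      _ ≤ _ := by gcongr
  refine (lintegral_mono hpt).trans ?_
  have hm : Measurable fun q : G × G =>
      f q.2 ^ 2 / k₁ q.2 * (g (q.1 - q.2) ^ 2 / k₂ (q.1 - q.2)) := by
    fun_prop
  rw [lintegral_const_mul _ hm.lintegral_prod_right',
    lintegral_lintegral_mul_sub (a := fun z => f z ^ 2 / k₁ z) (b := fun w => g w ^ 2 / k₂ w)
      (by fun_prop) (by fun_prop)]

/-- Schur test with an input frequency frozen. -/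
lemma lintegral_mul_sq_conv_le_of_input {k₁ k₂ k₀ : G → ENNReal} (h₁ : Measurable k₁)
    (h₂ : Measurable k₂) (h₀ : Measurable k₀) (h₁0 : ∀ x, k₁ x ≠ 0) (h₁t : ∀ x, k₁ x ≠ ⊤)
    (h₂0 : ∀ x, k₂ x ≠ 0) (h₂t : ∀ x, k₂ x ≠ ⊤) (h₀0 : ∀ x, k₀ x ≠ 0) (h₀t : ∀ x, k₀ x ≠ ⊤)
    {S : Set (G × G)} (hS : MeasurableSet S) {C : ENNReal}
    (hC : ∀ z, ∫⁻ w, {w | (z, w) ∈ S}.indicator (fun w => k₁ z * k₂ w * k₀ (z + w)) w ∂μ ≤ C)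
    {f g : G → ENNReal} (hf : Measurable f) (hg : Measurable g)
    (hfin : ∫⁻ y, k₀ y *
      (∫⁻ z, {z | (z, y - z) ∈ S}.indicator (fun z => f z * g (y - z)) z ∂μ) ^ 2 ∂μ ≠ ⊤) :
    ∫⁻ y, k₀ y * (∫⁻ z, {z | (z, y - z) ∈ S}.indicator (fun z => f z * g (y - z)) z ∂μ) ^ 2 ∂μ ≤
      C * ((∫⁻ z, f z ^ 2 / k₁ z ∂μ) * ∫⁻ w, g w ^ 2 / k₂ w ∂μ) := by
  set F : G → ENNReal := fun y =>
    ∫⁻ z, {z | (z, y - z) ∈ S}.indicator (fun z => f z * g (y - z)) z ∂μ with hF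
  set N := ∫⁻ y, k₀ y * F y ^ 2 ∂μ with hN
  have hSm : ∀ φ : G × G → ENNReal, Measurable φ → Measurable fun q : G × G =>
      {z | (z, q.1 - z) ∈ S}.indicator (fun z => φ (q.1, z)) q.2 := by
    intro φ hφ
    exact Measurable.indicator (s := {q : G × G | (q.2, q.1 - q.2) ∈ S}) (f := φ) hφ
      ((by fun_prop : Measurable fun q : G × G => (q.2, q.1 - q.2)) hS)
  have hFm : Measurable F :=
    (hSm (fun q => f q.2 * g (q.1 - q.2)) (by fun_prop)).lintegral_prod_right'
  set h : G → ENNReal := fun y => k₀ y * F y with hh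
  have hhm : Measurable h := h₀.mul hFm
  set I : G → ENNReal := fun z =>
    ∫⁻ w, {w | (z, w) ∈ S}.indicator (fun w => g w * h (z + w)) w ∂μ with hI
  have hIm : Measurable I := by
    refine Measurable.lintegral_prod_right' (f := fun q : G × G =>
      {w | (q.1, w) ∈ S}.indicator (fun w => g w * h (q.1 + w)) q.2) ?_
    exact Measurable.indicator (s := S) (f := fun q => g q.2 * h (q.1 + q.2)) (by fun_prop) hS
  have hNI : N = ∫⁻ z, f z * I z ∂μ := by
    calc N = ∫⁻ y, ∫⁻ z, h y *
          {z | (z, y - z) ∈ S}.indicator (fun z => f z * g (y - z)) z ∂μ ∂μ := by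
          refine lintegral_congr fun y => ?_
          have hmy : Measurable fun z =>
              {z | (z, y - z) ∈ S}.indicator (fun z => f z * g (y - z)) z :=
            (hSm (fun q => f q.2 * g (q.1 - q.2)) (by fun_prop)).comp measurable_prodMk_left
          rw [lintegral_const_mul _ hmy, sq]
          exact (mul_assoc _ _ _).symm
      _ = ∫⁻ z, ∫⁻ y, h y *
          {z | (z, y - z) ∈ S}.indicator (fun z => f z * g (y - z)) z ∂μ ∂μ := by
          refine lintegral_lintegral_swap ?_
          exact ((hhm.comp measurable_fst).mul
            (hSm (fun q => f q.2 * g (q.1 - q.2)) (by fun_prop))).aemeasurable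
      _ = ∫⁻ z, f z * I z ∂μ := by
          refine lintegral_congr fun z => ?_
          have hmw : Measurable fun w => {w | (z, w) ∈ S}.indicator (fun w => g w * h (z + w)) w :=
            Measurable.indicator (by fun_prop) (measurable_prodMk_left hS)
          simp only [hI]
          rw [← lintegral_const_mul _ hmw, ← lintegral_add_left_eq_self (fun y => h y *
              {z | (z, y - z) ∈ S}.indicator (fun z => f z * g (y - z)) z) z]
          refine lintegral_congr fun w => ?_
          by_cases hw : (z, w) ∈ S
          · simp only [Set.indicator, Set.mem_ofPred_eq, add_sub_cancel_left, hw, if_true]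
            ring
          · simp only [Set.indicator, Set.mem_ofPred_eq, add_sub_cancel_left, hw, if_false,
              mul_zero]
  have hIle : ∀ z, k₁ z * I z ^ 2 ≤ C * ∫⁻ w, g w ^ 2 / k₂ w * (h (z + w) ^ 2 / k₀ (z + w)) ∂μ := by
    intro z
    have hcs := sq_lintegral_indicator_le μ (F := fun w => g w * h (z + w))
      (k := fun w => k₂ w * k₀ (z + w)) (by fun_prop) (by fun_prop)
      (fun w => mul_ne_zero (h₂0 w) (h₀0 _)) (fun w => ENNReal.mul_ne_top (h₂t w) (h₀t _))
      (measurable_prodMk_left hS : MeasurableSet {w | (z, w) ∈ S})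
    have e1 : ∀ w, (g w * h (z + w)) ^ 2 / (k₂ w * k₀ (z + w)) =
        g w ^ 2 / k₂ w * (h (z + w) ^ 2 / k₀ (z + w)) := by
      intro w
      rw [mul_pow, ENNReal.mul_div_mul_comm (Or.inr (h₀t _)) (Or.inl (h₂t _))]
    simp_rw [e1] at hcs
    have h' := hC z
    have e2 : ∀ w, {w | (z, w) ∈ S}.indicator (fun w => k₁ z * k₂ w * k₀ (z + w)) w =
        k₁ z * {w | (z, w) ∈ S}.indicator (fun w => k₂ w * k₀ (z + w)) w := by
      intro w
      by_cases hw : w ∈ {w | (z, w) ∈ S}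
      · rw [Set.indicator_of_mem hw, Set.indicator_of_mem hw, mul_assoc]
      · rw [Set.indicator_of_notMem hw, Set.indicator_of_notMem hw, mul_zero]
    simp_rw [e2] at h'
    rw [lintegral_const_mul' _ _ (h₁t z)] at h'
    calc _ ≤ k₁ z * ((∫⁻ w, g w ^ 2 / k₂ w * (h (z + w) ^ 2 / k₀ (z + w)) ∂μ) *
          ∫⁻ w, {w | (z, w) ∈ S}.indicator (fun w => k₂ w * k₀ (z + w)) w ∂μ) :=
          mul_le_mul_right hcs _
      _ = (k₁ z * ∫⁻ w, {w | (z, w) ∈ S}.indicator (fun w => k₂ w * k₀ (z + w)) w ∂μ) *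
          ∫⁻ w, g w ^ 2 / k₂ w * (h (z + w) ^ 2 / k₀ (z + w)) ∂μ := by ring
      _ ≤ _ := by gcongr
  have hsum : ∫⁻ z, ∫⁻ w, g w ^ 2 / k₂ w * (h (z + w) ^ 2 / k₀ (z + w)) ∂μ ∂μ =
      (∫⁻ w, g w ^ 2 / k₂ w ∂μ) * N := by
    have e : ∀ y, h y ^ 2 / k₀ y = k₀ y * F y ^ 2 := by
      intro y
      calc h y ^ 2 / k₀ y = k₀ y * F y ^ 2 * (k₀ y / k₀ y) := by
            rw [hh, div_eq_mul_inv, div_eq_mul_inv]; ring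
        _ = _ := by rw [ENNReal.div_self (h₀0 y) (h₀t y), mul_one]
    rw [lintegral_lintegral_swap (by fun_prop)]
    simp_rw [fun w => lintegral_const_mul (μ := μ) (g w ^ 2 / k₂ w)
      (by fun_prop : Measurable fun z => h (z + w) ^ 2 / k₀ (z + w)),
      fun w => lintegral_add_right_eq_self (μ := μ) (fun y => h y ^ 2 / k₀ y) w, e]
    rw [lintegral_mul_const _ (by fun_prop)]
  have hfinal : N ^ 2 ≤ C * ((∫⁻ z, f z ^ 2 / k₁ z ∂μ) * ∫⁻ w, g w ^ 2 / k₂ w ∂μ) * N := by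
    have hm : Measurable fun q : G × G =>
        g q.2 ^ 2 / k₂ q.2 * (h (q.1 + q.2) ^ 2 / k₀ (q.1 + q.2)) := by fun_prop
    calc N ^ 2 ≤ (∫⁻ z, f z ^ 2 / k₁ z ∂μ) * ∫⁻ z, k₁ z * I z ^ 2 ∂μ := by
          rw [hNI]; exact sq_lintegral_mul_le μ hf hIm h₁ h₁0 h₁t
      _ ≤ (∫⁻ z, f z ^ 2 / k₁ z ∂μ) * (C * ((∫⁻ w, g w ^ 2 / k₂ w ∂μ) * N)) := by
          refine mul_le_mul_right ((lintegral_mono hIle).trans_eq ?_) _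
          rw [lintegral_const_mul _ hm.lintegral_prod_right', hsum]
      _ = _ := by ring
  by_cases hN0 : N = 0
  · rw [hN0]; exact zero_le
  · rw [sq] at hfinal
    exact (ENNReal.mul_le_mul_iff_left hN0 hfin).1 hfinal

/-- Schur test for a trilinear form whose kernel is split into two parts, one of which is summed
with the output frequency frozen and the other with an input frequency frozen. -/
lemma lintegral_mul_sq_conv_le {k₁ k₂ k₀ : G → ENNReal} (h₁ : Measurable k₁)
    (h₂ : Measurable k₂) (h₀ : Measurable k₀) (h₁0 : ∀ x, k₁ x ≠ 0) (h₁t : ∀ x, k₁ x ≠ ⊤)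
    (h₂0 : ∀ x, k₂ x ≠ 0) (h₂t : ∀ x, k₂ x ≠ ⊤) (h₀0 : ∀ x, k₀ x ≠ 0) (h₀1 : ∀ x, k₀ x ≤ 1)
    {S : Set (G × G)} (hS : MeasurableSet S) {C : ENNReal}
    (hout : ∀ y, ∫⁻ z, {z | (z, y - z) ∈ S}.indicator
      (fun z => k₁ z * k₂ (y - z) * k₀ y) z ∂μ ≤ C)
    (hin : ∀ z, ∫⁻ w, {w | (z, w) ∈ Sᶜ}.indicator (fun w => k₁ z * k₂ w * k₀ (z + w)) w ∂μ ≤ C)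
    {f g : G → ENNReal} (hf : Measurable f) (hg : Measurable g) {M : ENNReal} (hM : M ≠ ⊤)
    (hgM : ∀ z, g z ≤ M) (hfi : ∫⁻ z, f z ∂μ ≠ ⊤) (hgi : ∫⁻ z, g z ∂μ ≠ ⊤) :
    ∫⁻ y, k₀ y * (∫⁻ z, f z * g (y - z) ∂μ) ^ 2 ∂μ ≤
      4 * C * ((∫⁻ z, f z ^ 2 / k₁ z ∂μ) * ∫⁻ w, g w ^ 2 / k₂ w ∂μ) := by
  have h₀t : ∀ x, k₀ x ≠ ⊤ := fun x => ne_top_of_le_ne_top ENNReal.one_ne_top (h₀1 x)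
  set A : G → ENNReal := fun y =>
    ∫⁻ z, {z | (z, y - z) ∈ S}.indicator (fun z => f z * g (y - z)) z ∂μ with hA
  set B : G → ENNReal := fun y =>
    ∫⁻ z, {z | (z, y - z) ∈ Sᶜ}.indicator (fun z => f z * g (y - z)) z ∂μ with hB
  have hmeas (T : Set (G × G)) (hT : MeasurableSet T) :
      Measurable fun q : G × G =>
        {z | (z, q.1 - z) ∈ T}.indicator (fun z => f z * g (q.1 - z)) q.2 :=
    Measurable.indicator (s := {q : G × G | (q.2, q.1 - q.2) ∈ T})
      (f := fun q => f q.2 * g (q.1 - q.2)) (by fun_prop)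
      ((by fun_prop : Measurable fun q : G × G => (q.2, q.1 - q.2)) hT)
  have hAm : Measurable A := (hmeas S hS).lintegral_prod_right'
  have hBm : Measurable B := (hmeas Sᶜ hS.compl).lintegral_prod_right'
  have hsplit : ∀ y, ∫⁻ z, f z * g (y - z) ∂μ = A y + B y := by
    intro y
    rw [hA, hB]
    simp only
    have hmy : Measurable fun z => {z | (z, y - z) ∈ S}.indicator (fun z => f z * g (y - z)) z :=
      (hmeas S hS).comp measurable_prodMk_left
    rw [← lintegral_add_left hmy]
    refine lintegral_congr fun z => ?_
    by_cases hz : (z, y - z) ∈ S <;> simp [Set.indicator, hz]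
  set R := (∫⁻ z, f z ^ 2 / k₁ z ∂μ) * ∫⁻ w, g w ^ 2 / k₂ w ∂μ with hR
  have hAle : ∫⁻ y, k₀ y * A y ^ 2 ∂μ ≤ C * R :=
    lintegral_mul_sq_conv_le_of_output h₁ h₂ h₁0 h₁t h₂0 h₂t hS hout h₀t hf hg
  have hBfin : ∫⁻ y, k₀ y * B y ^ 2 ∂μ ≠ ⊤ := by
    have hconv : ∀ y, B y ≤ ∫⁻ z, f z * g (y - z) ∂μ := fun y => by
      rw [hsplit]; exact le_add_self
    have hK : ∀ y, B y ≤ M * ∫⁻ z, f z ∂μ := fun y => by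
      refine (hconv y).trans ?_
      rw [← lintegral_const_mul _ hf]
      exact lintegral_mono fun z => (mul_comm _ _).trans_le (mul_le_mul_left (hgM _) _)
    refine ne_top_of_le_ne_top (ENNReal.mul_ne_top (ENNReal.mul_ne_top hM hfi)
      (ENNReal.mul_ne_top hfi hgi)) ?_
    calc ∫⁻ y, k₀ y * B y ^ 2 ∂μ
        ≤ ∫⁻ y, (M * ∫⁻ z, f z ∂μ) * ∫⁻ z, f z * g (y - z) ∂μ ∂μ := by
          refine lintegral_mono fun y => ?_
          calc k₀ y * B y ^ 2 ≤ 1 * B y ^ 2 :=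
                mul_le_mul_left (h₀1 y) _
            _ = B y * B y := by rw [one_mul, sq]
            _ ≤ _ := mul_le_mul' (hK y) (hconv y)
      _ = _ := by
          rw [lintegral_const_mul' _ _ (ENNReal.mul_ne_top hM hfi),
            lintegral_lintegral_mul_sub hf hg]
  have hBle : ∫⁻ y, k₀ y * B y ^ 2 ∂μ ≤ C * R :=
    lintegral_mul_sq_conv_le_of_input h₁ h₂ h₀ h₁0 h₁t h₂0 h₂t h₀0 h₀t hS.compl hin hf hg hBfin
  calc ∫⁻ y, k₀ y * (∫⁻ z, f z * g (y - z) ∂μ) ^ 2 ∂μ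
      ≤ ∫⁻ y, 2 * (k₀ y * A y ^ 2 + k₀ y * B y ^ 2) ∂μ := by
        refine lintegral_mono fun y => ?_
        rw [hsplit, ← mul_add, mul_left_comm]
        exact mul_le_mul_right (ENNReal.add_sq_le_two_mul _ _) _
    _ ≤ 2 * (C * R + C * R) := by
        rw [lintegral_const_mul _ (by fun_prop), lintegral_add_left (by fun_prop)]
        gcongr
    _ = 4 * C * R := by ring

end Schur

lemma decay_le_one {p : ℝ} (hp : 0 ≤ p) (x : ℝ) : decay p x ≤ 1 :=
  (decay_anti hp (by simp : |(0 : ℝ)| ≤ |x|)).trans_eq (by simp [decay])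

/-- The reciprocal of the weight of the wave-Sobolev norms. -/
def waveWeight (α p : ℝ) (ζ : SpaceTime) : ENNReal :=
  ENNReal.ofReal (decay α (nrm (spatial ζ)) * decay p (|ζ 0| - nrm (spatial ζ)))

@[fun_prop]
lemma measurable_waveWeight (α p : ℝ) : Measurable (waveWeight α p) := by
  unfold waveWeight nrm
  fun_prop

lemma waveWeight_ne_zero (α p : ℝ) (ζ : SpaceTime) : waveWeight α p ζ ≠ 0 :=
  (ENNReal.ofReal_pos.2 (mul_pos (decay_pos _ _) (decay_pos _ _))).ne'

lemma waveWeight_ne_top (α p : ℝ) (ζ : SpaceTime) : waveWeight α p ζ ≠ ⊤ := ENNReal.ofReal_ne_top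

lemma waveWeight_le_one {α p : ℝ} (hα : 0 ≤ α) (hp : 0 ≤ p) (ζ : SpaceTime) :
    waveWeight α p ζ ≤ 1 :=
  ENNReal.ofReal_le_one.2 (mul_le_one₀ (decay_le_one hα _) (decay_nonneg _ _) (decay_le_one hp _))

lemma waveWeight_mul_eq (α β γ p : ℝ) (z w : SpaceTime) :
    waveWeight α 0 z * waveWeight α p w * waveWeight β γ (z + w) =
      ENNReal.ofReal (waveKernel α β γ p (z 0) (spatial z) (w 0) (spatial w)) := by
  have h0 : decay 0 (|z 0| - nrm (spatial z)) = 1 := by simp [decay]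
  rw [waveWeight, waveWeight, waveWeight, h0, mul_one, ← ENNReal.ofReal_mul (decay_nonneg _ _),
    ← ENNReal.ofReal_mul (mul_nonneg (decay_nonneg _ _)
      (mul_nonneg (decay_nonneg _ _) (decay_nonneg _ _))), waveKernel, spatial_add]
  rfl

/-- The bilinear estimate on the Fourier side. -/
lemma exists_lintegral_conv_le {α β γ p : ℝ} (hp : 1 < p) (hγ : 1 / 2 < γ) (hγp : γ ≤ p)
    (hα : 0 ≤ α) (hα' : α < 1 / 2) (hβ : 0 ≤ β) (hβ' : β < 3 / 2) (hαβ' : 1 < α + β)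
    (hαβ : 3 / 2 ≤ 2 * α + β) :
    ∃ C : ℝ, 0 < C ∧ ∀ f g : SpaceTime → ENNReal, Measurable f → Measurable g →
      (∃ M ≠ ⊤, ∀ z, g z ≤ M) → ∫⁻ z, f z ≠ ⊤ → ∫⁻ z, g z ≠ ⊤ →
      ∫⁻ y, waveWeight β γ y * (∫⁻ z, f z * g (y - z)) ^ 2 ≤
        ENNReal.ofReal C * ((∫⁻ z, f z ^ 2 / waveWeight α 0 z) *
          ∫⁻ w, g w ^ 2 / waveWeight α p w) := by
  obtain ⟨C, hC, hout, hin⟩ :=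
    exists_lintegral_waveKernel_le hp hγ hγp hα hα' hβ hβ' hαβ' hαβ
  refine ⟨4 * C, by positivity, fun f g hf hg ⟨M, hM, hgM⟩ hfi hgi => ?_⟩
  have hS : MeasurableSet {q : SpaceTime × SpaceTime |
      AlmostParallel (q.1 0) (spatial q.1) (q.2 0) (spatial q.2)} :=
    measurableSet_almostParallel (by fun_prop) (by fun_prop) (by fun_prop) (by fun_prop)
  rw [ENNReal.ofReal_mul (by norm_num), ENNReal.ofReal_ofNat]
  refine lintegral_mul_sq_conv_le (μ := volume) (by fun_prop) (by fun_prop) (by fun_prop)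
    (waveWeight_ne_zero _ _) (waveWeight_ne_top _ _) (waveWeight_ne_zero _ _)
    (waveWeight_ne_top _ _) (waveWeight_ne_zero _ _)
    (waveWeight_le_one hβ (by linarith)) hS (fun y => ?_) (fun z => ?_) hf hg hM hgM hfi hgi
  · have e : ∀ z, waveWeight α 0 z * waveWeight α p (y - z) * waveWeight β γ y =
        ENNReal.ofReal (waveKernel α β γ p (z 0) (spatial z) ((y - z) 0) (spatial (y - z))) :=
      fun z => by rw [← waveWeight_mul_eq, add_sub_cancel]
    simp_rw [e]
    exact hout y
  · simp_rw [waveWeight_mul_eq]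
    exact hin z

open scoped SchwartzMap Convolution in
lemma enorm_fourier_mul_le (u v : 𝓢(SpaceTime, ℂ)) (y : SpaceTime) :
    ‖𝓕 (fun x => u x * v x) y‖ₑ ≤ ∫⁻ z, ‖𝓕 u z‖ₑ * ‖𝓕 v (y - z)‖ₑ := by
  have hinv : ∀ (w : 𝓢(SpaceTime, ℂ)) x, 𝓕 (𝓕 w) (-x) = w x := fun w x => by
    conv_rhs => rw [← FourierTransform.fourierInv_fourier_eq (F := 𝓢(SpaceTime, ℂ)) w]
    rw [SchwartzMap.fourierInv_coe, Real.fourierInv_eq_fourier_neg, SchwartzMap.fourier_coe (𝓕 w)]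
  have h : 𝓕 (fun x => u x * v x) y =
      SchwartzMap.convolution (ContinuousLinearMap.mul ℂ ℂ) (𝓕 u) (𝓕 v) y := by
    change _ = 𝓕⁻ (SchwartzMap.pairing (ContinuousLinearMap.mul ℂ ℂ) (𝓕 (𝓕 u)) (𝓕 (𝓕 v))) y
    rw [SchwartzMap.fourierInv_coe, Real.fourierInv_eq_fourier_comp_neg]
    refine congrArg (fun h : SpaceTime → ℂ => 𝓕 h y) (funext fun x => ?_)
    simp [SchwartzMap.pairing_apply_apply, hinv]
  rw [h, SchwartzMap.convolution_apply, convolution_def]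
  refine (enorm_integral_le_lintegral_enorm _).trans_eq (lintegral_congr fun z => ?_)
  rw [ContinuousLinearMap.mul_apply', enorm_mul]

lemma spFreq_nonneg (ζ : SpaceTime) : 0 ≤ spFreq ζ := Real.sqrt_nonneg _

lemma spFreq_le_norm (ζ : SpaceTime) : spFreq ζ ≤ ‖ζ‖ := by
  rw [EuclideanSpace.norm_eq, Fin.sum_univ_three]
  refine Real.sqrt_le_sqrt ?_
  simp only [norm_eq_abs, sq_abs]
  nlinarith [sq_nonneg (ζ 0)]

lemma abs_abs_sub_spFreq_le_norm (ζ : SpaceTime) : |(|ζ 0| - spFreq ζ)| ≤ ‖ζ‖ :=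
  abs_sub_le_of_nonneg_of_le (abs_nonneg _) (PiLp.norm_apply_le ζ 0) (spFreq_nonneg ζ)
    (spFreq_le_norm ζ)

open scoped SchwartzMap in
lemma integrable_waveNorm_integrand {a c : ℝ} (ha : a ≤ 1) (hc : c ≤ 2) (v : 𝓢(SpaceTime, ℂ)) :
    Integrable fun ζ : SpaceTime => (1 + (spFreq ζ) ^ 2) ^ a *
      (1 + |(|ζ 0| - spFreq ζ)|) ^ c * ‖v ζ‖ ^ 2 := by
  set M := SchwartzMap.seminorm ℝ 0 0 v
  have hInt : Integrable fun ζ : SpaceTime => 8 * M * (‖v ζ‖ + ‖ζ‖ ^ 4 * ‖v ζ‖) :=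
    (v.integrable.norm.add (v.integrable_pow_mul volume 4)).const_mul _
  have hm : Measurable spFreq := by unfold spFreq; fun_prop
  refine hInt.mono' (Measurable.aestronglyMeasurable ?_) (ae_of_all _ fun ζ => ?_)
  · have := v.continuous.measurable
    fun_prop
  have h0 := spFreq_nonneg ζ
  have h1 := spFreq_le_norm ζ
  have h2 := abs_nonneg (|ζ 0| - spFreq ζ)
  have h3 := abs_abs_sub_spFreq_le_norm ζ
  have h4 := norm_nonneg ζ
  have hM : ‖v ζ‖ ≤ M := v.norm_le_seminorm ℝ ζ
  have e1 : (1 + (spFreq ζ) ^ 2) ^ a ≤ (1 + ‖ζ‖) ^ 2 := by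
    refine (rpow_le_rpow_of_exponent_le (by nlinarith) ha).trans ?_
    rw [rpow_one]
    nlinarith
  have e2 : (1 + |(|ζ 0| - spFreq ζ)|) ^ c ≤ (1 + ‖ζ‖) ^ 2 := by
    refine (rpow_le_rpow_of_exponent_le (by linarith) hc).trans ?_
    rw [rpow_two]
    gcongr
  have e3 : (1 + ‖ζ‖) ^ 2 * (1 + ‖ζ‖) ^ 2 ≤ 8 * (1 + ‖ζ‖ ^ 4) := by
    nlinarith [sq_nonneg (‖ζ‖ - 1), sq_nonneg (‖ζ‖ ^ 2 - 1), mul_nonneg h4 (sq_nonneg (‖ζ‖ - 1)),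
      mul_nonneg (sq_nonneg ‖ζ‖) (sq_nonneg (‖ζ‖ - 1))]
  rw [norm_of_nonneg (by positivity)]
  calc _ ≤ ((1 + ‖ζ‖) ^ 2 * (1 + ‖ζ‖) ^ 2) * (‖v ζ‖ * ‖v ζ‖) := by
        rw [sq ‖v ζ‖]; gcongr
    _ ≤ (8 * (1 + ‖ζ‖ ^ 4)) * (M * ‖v ζ‖) := by gcongr
    _ = _ := by ring

lemma one_add_rpow_le {r σ : ℝ} (hr : 0 ≤ r) (hσ : 0 ≤ σ) :
    (1 + r) ^ (2 * σ) ≤ 2 ^ σ * (1 + r ^ 2) ^ σ := by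
  rw [rpow_mul (by positivity), ← mul_rpow (by norm_num) (by positivity)]
  refine rpow_le_rpow (by positivity) ?_ hσ
  rw [rpow_two]
  nlinarith [sq_nonneg (r - 1)]

lemma sq_waveNorm (s b : ℝ) (f : SpaceTime → ℂ) : waveNorm s b f ^ 2 =
    ∫ ζ : SpaceTime, (1 + (spFreq ζ) ^ 2) ^ s * (1 + |(|ζ 0| - spFreq ζ)|) ^ (2 * b) *
      ‖𝓕 f ζ‖ ^ 2 := by
  rw [waveNorm, ← rpow_natCast, ← rpow_mul (integral_nonneg fun ζ => by positivity)]
  norm_num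

lemma waveNorm_nonneg (s b : ℝ) (f : SpaceTime → ℂ) : 0 ≤ waveNorm s b f :=
  rpow_nonneg (integral_nonneg fun ζ => by positivity) _

open scoped SchwartzMap in
lemma lintegral_div_waveWeight_le {α p σ b : ℝ} (hσ : 0 ≤ σ) (hσ' : σ ≤ 1) (hασ : α ≤ 2 * σ)
    (hpb : p ≤ 2 * b) (hb : b ≤ 1) (v : 𝓢(SpaceTime, ℂ)) :
    ∫⁻ ζ, ‖𝓕 v ζ‖ₑ ^ 2 / waveWeight α p ζ ≤ ENNReal.ofReal (2 * waveNorm σ b v ^ 2) := by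
  rw [sq_waveNorm, ← integral_const_mul, ofReal_integral_eq_lintegral_ofReal]
  · refine lintegral_mono fun ζ => ?_
    have h0 := spFreq_nonneg ζ
    have hx := abs_nonneg (|ζ 0| - spFreq ζ)
    rw [waveWeight, ← ofReal_norm, ← ENNReal.ofReal_pow (norm_nonneg _),
      ← ENNReal.ofReal_div_of_pos (mul_pos (decay_pos _ _) (decay_pos _ _)),
      ← SchwartzMap.fourier_coe, ← spFreq_eq_nrm]
    refine ENNReal.ofReal_le_ofReal ?_
    rw [div_le_iff₀ (mul_pos (decay_pos _ _) (decay_pos _ _)), decay, decay, abs_of_nonneg h0,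
      rpow_neg (by positivity), rpow_neg (by positivity)]
    have h1 : (1 + spFreq ζ) ^ α ≤ 2 * (1 + spFreq ζ ^ 2) ^ σ := by
      calc (1 + spFreq ζ) ^ α ≤ (1 + spFreq ζ) ^ (2 * σ) :=
            rpow_le_rpow_of_exponent_le (by linarith) hασ
        _ ≤ 2 ^ σ * (1 + spFreq ζ ^ 2) ^ σ := one_add_rpow_le h0 hσ
        _ ≤ 2 * (1 + spFreq ζ ^ 2) ^ σ := by
          gcongr
          exact (rpow_le_rpow_of_exponent_le (by norm_num) hσ').trans_eq (rpow_one 2)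
    have h2 : (1 + |(|ζ 0| - spFreq ζ)|) ^ p ≤ (1 + |(|ζ 0| - spFreq ζ)|) ^ (2 * b) :=
      rpow_le_rpow_of_exponent_le (by linarith) hpb
    rw [← mul_inv, ← div_eq_mul_inv, le_div_iff₀ (by positivity), mul_comm (‖_‖ ^ 2), ← mul_assoc,
      ← mul_assoc]
    gcongr
  · exact (integrable_waveNorm_integrand hσ' (by linarith) (𝓕 v)).const_mul 2
  · exact ae_of_all _ fun ζ => by positivity

lemma sq_waveNorm_le_of_lintegral_le {β γ σ b D : ℝ} (hσ : 0 ≤ σ) (hσ' : σ ≤ 2) (hβσ : β ≤ 2 * σ)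
    (hγb : γ = -(2 * b)) (hD : 0 ≤ D) {f : SpaceTime → ℂ}
    (h : ∫⁻ ζ, waveWeight β γ ζ * ‖𝓕 f ζ‖ₑ ^ 2 ≤ ENNReal.ofReal D) :
    waveNorm (-σ) b f ^ 2 ≤ 4 * D := by
  have hpt : ∀ ζ : SpaceTime, ENNReal.ofReal ‖(1 + (spFreq ζ) ^ 2) ^ (-σ) *
      (1 + |(|ζ 0| - spFreq ζ)|) ^ (2 * b) * ‖𝓕 f ζ‖ ^ 2‖ ≤
        4 * (waveWeight β γ ζ * ‖𝓕 f ζ‖ₑ ^ 2) := by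
    intro ζ
    have h0 := spFreq_nonneg ζ
    have hx := abs_nonneg (|ζ 0| - spFreq ζ)
    rw [waveWeight, ← ofReal_norm, ← ENNReal.ofReal_pow (norm_nonneg _),
      ← ENNReal.ofReal_mul (mul_nonneg (decay_nonneg _ _) (decay_nonneg _ _)),
      ← ENNReal.ofReal_ofNat 4, ← ENNReal.ofReal_mul (by norm_num), ← spFreq_eq_nrm,
      norm_of_nonneg (by positivity)]
    refine ENNReal.ofReal_le_ofReal ?_
    rw [decay, decay, abs_of_nonneg h0, hγb, neg_neg, ← mul_assoc, ← mul_assoc]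
    gcongr
    have h1 : (1 + spFreq ζ) ^ β ≤ 4 * (1 + spFreq ζ ^ 2) ^ σ := by
      calc (1 + spFreq ζ) ^ β ≤ (1 + spFreq ζ) ^ (2 * σ) :=
            rpow_le_rpow_of_exponent_le (by linarith) hβσ
        _ ≤ 2 ^ σ * (1 + spFreq ζ ^ 2) ^ σ := one_add_rpow_le h0 hσ
        _ ≤ 4 * (1 + spFreq ζ ^ 2) ^ σ := by
          gcongr
          exact (rpow_le_rpow_of_exponent_le (by norm_num) hσ').trans_eq (by norm_num)
    rw [rpow_neg (by positivity), rpow_neg (by positivity), ← div_eq_mul_inv,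
      le_div_iff₀ (by positivity), inv_mul_le_iff₀ (by positivity), mul_comm]
    exact h1
  rw [sq_waveNorm]
  refine (Real.le_norm_self _).trans ((norm_integral_le_lintegral_norm _).trans ?_)
  refine ENNReal.toReal_le_of_le_ofReal (by positivity) ((lintegral_mono hpt).trans ?_)
  rw [lintegral_const_mul' _ _ (by norm_num), ENNReal.ofReal_mul (by norm_num),
    ENNReal.ofReal_ofNat]
  gcongr

theorem nullA_high_estimate_2 (s s' θ₀ θ₁ : ℝ)
    (hs1 : 1/4 < s') (hs2 : s' ≤ 1) (hs3 : 1/2 < s) (hs4 : s ≤ 1)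
    (hs5 : max (3/2 - 2 * s) (s/2 - 1/8) < s') (hs6 : s' < 4 * s - 3/2)
    (hθ0 : 1/2 < θ₀) (hθ0b : θ₀ < 3/4)
    (hθ1 : max (1/2) (1 - s') < θ₁)
    (hθ1b : θ₁ < min (3/4) (min (4 * s - s' - 1) (2 * s - 1/2))) :
    ∃ ε₀ > 0, ∀ ε : ℝ, 0 < ε → ε ≤ ε₀ → ∃ C > 0, ∀ u v : SchwartzMap SpaceTime ℂ,
      waveNorm (s' - 3/2) (θ₁ - 1 + ε) (fun x => u x * v x) ≤
        C * waveNorm (s - 1/2) (θ₀ - 1/2) (fun x => u x) *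
          waveNorm (s - 1/2) θ₀ (fun x => v x) := by
  have hθ₁ : 1 / 2 < θ₁ := (le_max_left _ _).trans_lt hθ1
  have hθ₁' : θ₁ < 3 / 4 := hθ1b.trans_le (min_le_left _ _)
  refine ⟨(3 / 4 - θ₁) / 2, by linarith, fun ε hε hε' => ?_⟩
  obtain ⟨a, ha0, ha1, ha2, ha3⟩ : ∃ a : ℝ, 0 < a ∧ a < 1 / 2 ∧ a ≤ 2 * (s - 1 / 2) ∧
      (a = 2 * (s - 1 / 2) ∨ a = 2 / 5) := by
    rcases le_total (2 * (s - 1 / 2)) (2 / 5) with h | h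
    · exact ⟨_, by linarith, by linarith, le_rfl, Or.inl rfl⟩
    · exact ⟨2 / 5, by norm_num, by norm_num, h, Or.inr rfl⟩
  obtain ⟨β, hβ0, hβ1, hβ2, hβ3, hβ4⟩ : ∃ β : ℝ, 0 ≤ β ∧ β < 3 / 2 ∧ β ≤ 2 * (3 / 2 - s') ∧
      1 < a + β ∧ 3 / 2 ≤ 2 * a + β := by
    rcases le_total (2 * (3 / 2 - s')) (3 / 2 - a) with h | h
    · refine ⟨_, by linarith, by linarith, le_rfl, by linarith, ?_⟩
      rcases ha3 with h | h <;> rw [h] <;> linarith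
    · exact ⟨_, by linarith, by linarith, h, by linarith, by linarith⟩
  obtain ⟨C, hC, hconv⟩ := exists_lintegral_conv_le (α := a) (β := β)
    (γ := -(2 * (θ₁ - 1 + ε))) (p := 2 * θ₀) (by linarith) (by linarith) (by linarith) ha0.le ha1
    hβ0 hβ1 hβ3 hβ4
  refine ⟨4 * √C, by positivity, fun u v => ?_⟩
  set Nu := waveNorm (s - 1 / 2) (θ₀ - 1 / 2) (fun x => u x) with hNu
  set Nv := waveNorm (s - 1 / 2) θ₀ (fun x => v x) with hNv
  have hu := lintegral_div_waveWeight_le (α := a) (p := 0) (σ := s - 1 / 2) (b := θ₀ - 1 / 2)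
    (by linarith) (by linarith) ha2 (by linarith) (by linarith) u
  have hv := lintegral_div_waveWeight_le (α := a) (p := 2 * θ₀) (σ := s - 1 / 2) (b := θ₀)
    (by linarith) (by linarith) ha2 le_rfl (by linarith) v
  have hfin : ∀ w : SchwartzMap SpaceTime ℂ, ∫⁻ z, ‖𝓕 w z‖ₑ ≠ ⊤ := fun w =>
    (𝓕 w).integrable.2.ne
  have hbound : ∫⁻ y, waveWeight β (-(2 * (θ₁ - 1 + ε))) y *
      ‖𝓕 (fun x => u x * v x) y‖ₑ ^ 2 ≤ ENNReal.ofReal (C * (2 * Nu ^ 2 * (2 * Nv ^ 2))) := by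
    calc _ ≤ ∫⁻ y, waveWeight β (-(2 * (θ₁ - 1 + ε))) y *
          (∫⁻ z, ‖𝓕 u z‖ₑ * ‖𝓕 v (y - z)‖ₑ) ^ 2 := by
          gcongr with y
          exact enorm_fourier_mul_le u v y
      _ ≤ _ := hconv (fun z => ‖𝓕 u z‖ₑ) (fun z => ‖𝓕 v z‖ₑ)
          (𝓕 u).continuous.enorm.measurable (𝓕 v).continuous.enorm.measurable
          ⟨ENNReal.ofReal (SchwartzMap.seminorm ℝ 0 0 (𝓕 v)), ENNReal.ofReal_ne_top, fun z => by
            rw [← ofReal_norm]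
            exact ENNReal.ofReal_le_ofReal ((𝓕 v).norm_le_seminorm ℝ z)⟩ (hfin u) (hfin v)
      _ ≤ _ := by
          rw [ENNReal.ofReal_mul hC.le, ENNReal.ofReal_mul (by positivity)]
          gcongr
  have hN0 : 0 ≤ Nu * Nv := mul_nonneg (waveNorm_nonneg _ _ _) (waveNorm_nonneg _ _ _)
  have hsq := sq_waveNorm_le_of_lintegral_le (σ := 3 / 2 - s') (by linarith) (by linarith) hβ2 rfl
    (by positivity) hbound
  rw [neg_sub] at hsq
  rw [mul_assoc]
  refine le_of_sq_le_sq (hsq.trans_eq ?_) (by positivity)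
  rw [mul_pow, mul_pow, sq_sqrt hC.le]
  ring

end
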